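/- arXiv:1808.02475 — 10 statements merged into one kernel-verified Lean document; each statement's English description precedes it below -/
import Mathlib

section
/- Let (V, ⟨·,·⟩) be a finite-dimensional real inner product space and let R be an algebraic curvature tensor on V that is almost isotropic with associated constant κ. Then either R = κ·R_1, or there exist a constant τ ∈ {−1, 1} and a nonzero skew-symmetric endomorphism A : V → V such that R = κ·R_1 + τ·R_A. -/
open scoped InnerProductSpace

section CurvatureForm

variable {V : Type*}

/-- An algebraic curvature tensor in covariant form, `K x y z w = ⟪R x y z, w⟫`. -/
structure IsCurvatureForm [AddCommGroup V] [Module ℝ V] (K : V → V → V → V → ℝ) : Prop where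
  add_fst : ∀ x x' y z w, K (x + x') y z w = K x y z w + K x' y z w
  smul_fst : ∀ (s : ℝ) (x y z w), K (s • x) y z w = s * K x y z w
  skew : ∀ x y z w, K x y z w = -K y x z w
  pair : ∀ x y z w, K x y z w = K z w x y
  bianchi : ∀ x y z w, K x y z w + K y z x w + K z x y w = 0

namespace IsCurvatureForm

section Module

variable [AddCommGroup V] [Module ℝ V] {K L : V → V → V → V → ℝ}

lemma add_snd (hK : IsCurvatureForm K) (x y y' z w : V) :
    K x (y + y') z w = K x y z w + K x y' z w := by
  rw [hK.skew, hK.add_fst, hK.skew x y, hK.skew x y']; ring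

lemma add_trd (hK : IsCurvatureForm K) (x y z z' w : V) :
    K x y (z + z') w = K x y z w + K x y z' w := by
  rw [hK.pair, hK.add_fst, hK.pair x y, hK.pair x y]

lemma add_fth (hK : IsCurvatureForm K) (x y z w w' : V) :
    K x y z (w + w') = K x y z w + K x y z w' := by
  rw [hK.pair, hK.add_snd, hK.pair x y, hK.pair x y]

lemma smul_snd (hK : IsCurvatureForm K) (s : ℝ) (x y z w : V) :
    K x (s • y) z w = s * K x y z w := by
  rw [hK.skew, hK.smul_fst, hK.skew x y]; ring

lemma smul_trd (hK : IsCurvatureForm K) (s : ℝ) (x y z w : V) :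
    K x y (s • z) w = s * K x y z w := by
  rw [hK.pair, hK.smul_fst, hK.pair x y]

lemma smul_fth (hK : IsCurvatureForm K) (s : ℝ) (x y z w : V) :
    K x y z (s • w) = s * K x y z w := by
  rw [hK.pair, hK.smul_snd, hK.pair x y]

lemma reverse (hK : IsCurvatureForm K) (x y z w : V) : K x y z w = K w z y x := by
  rw [hK.pair, hK.skew, hK.pair, hK.skew, hK.pair]; ring

lemma swap_swap (hK : IsCurvatureForm K) (x y z w : V) : K x y z w = K y x w z := by
  rw [hK.reverse, hK.pair]

lemma sub (hK : IsCurvatureForm K) (hL : IsCurvatureForm L) :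
    IsCurvatureForm fun x y z w => K x y z w - L x y z w where
  add_fst x x' y z w := by rw [hK.add_fst, hL.add_fst]; ring
  smul_fst s x y z w := by rw [hK.smul_fst, hL.smul_fst]; ring
  skew x y z w := by rw [hK.skew, hL.skew]; ring
  pair x y z w := by rw [hK.pair, hL.pair]
  bianchi x y z w := by linear_combination hK.bianchi x y z w - hL.bianchi x y z w

lemma const_mul (hK : IsCurvatureForm K) (c : ℝ) :
    IsCurvatureForm fun x y z w => c * K x y z w where
  add_fst x x' y z w := by rw [hK.add_fst]; ring
  smul_fst s x y z w := by rw [hK.smul_fst]; ring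
  skew x y z w := by rw [hK.skew]; ring
  pair x y z w := by rw [hK.pair]
  bianchi x y z w := by linear_combination c * hK.bianchi x y z w

/-- A curvature form is determined by its sectional curvatures. -/
lemma eq_zero_of_sectional (hK : IsCurvatureForm K) (h : ∀ v w, K w v v w = 0) (x y z w : V) :
    K x y z w = 0 := by
  have polar (u v w : V) : K w v v u = 0 := by
    have e := h v (w + u)
    simp only [hK.add_fst, hK.add_fth, h] at e
    linarith [hK.reverse u v v w]
  have anti (x y z w : V) : K x y z w = -K x z y w := by
    have e := polar w (y + z) x
    simp only [hK.add_snd, hK.add_trd, polar] at e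
    linarith
  linarith [hK.bianchi x y z w, hK.skew y z x w, hK.skew z x y w, anti x y z w, anti y x z w,
    hK.skew y x z w]

/-- The sum of the two curvature components polarizing `K w v v w` in both variables. -/
def polarization (K : V → V → V → V → ℝ) (v v' w w' : V) : ℝ := K w v v' w' + K w v' v w'

lemma polarization_comm (hK : IsCurvatureForm K) (v v' w w' : V) :
    polarization K v v' w w' = polarization K w w' v v' := by
  simp only [polarization]
  rw [hK.swap_swap w v, hK.reverse w v', hK.pair w' v]
  rw [hK.reverse v w', hK.swap_swap v' w, hK.reverse w v', hK.pair w' v]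

/-- If all Jacobi operators have rank at most one, comparing coefficients in
`K b u u b * K w u u w = K b u u w ^ 2` along the line `u = a + s • v`. -/
lemma rank_one_coefficients (hK : IsCurvatureForm K)
    (hrank : ∀ v w u, K w v v w * K u v v u = K w v v u ^ 2) (a v b w : V) :
    K b a a b * polarization K a v w w + polarization K a v b b * K w a a w
        = 2 * K b a a w * polarization K a v b w ∧
    K b a a b * K w v v w + polarization K a v b b * polarization K a v w w
        + K b v v b * K w a a w
      = polarization K a v b w ^ 2 + 2 * K b a a w * K b v v w := by
  have e (s : ℝ) := hrank (a + s • v) b w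
  simp only [hK.add_snd, hK.add_trd, hK.smul_snd, hK.smul_trd] at e
  have e0 := e 0
  have e1 := e 1
  have e2 := e (-1)
  have e3 := e 2
  have e4 := e (-2)
  simp only [polarization]
  constructor
  · linear_combination (2 / 3) * (e1 - e2) - (1 / 12) * (e3 - e4)
  · linear_combination (2 / 3) * (e1 + e2) - (1 / 24) * (e3 + e4) - (5 / 4) * e0

/-- The bilinear form whose square is proportional to the sectional curvature form. -/
def rootForm (K : V → V → V → V → ℝ) (a b v w : V) : ℝ :=
  2 * K b a a b * polarization K a v b w - K b a a w * polarization K a v b b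

lemma rootForm_sq (hK : IsCurvatureForm K)
    (hrank : ∀ v w u, K w v v w * K u v v u = K w v v u ^ 2) (a b v w : V) :
    rootForm K a b v w ^ 2 = 4 * K b a a b ^ 3 * K w v v w := by
  obtain ⟨e₁, e₂⟩ := hK.rank_one_coefficients hrank a v b w
  have e₃ := (hK.rank_one_coefficients hrank b w a v).1
  have e₄ := hrank a b w
  have e₅ := hrank b a v
  have hdiag (x y z : V) : 2 * K x y y z = polarization K y y x z := by
    simp only [polarization]; ring
  rw [hdiag a b v, hK.polarization_comm b b, hK.polarization_comm b w, hK.polarization_comm b w,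
    hK.polarization_comm b w, ← hdiag, ← hdiag, hK.swap_swap a b b a, hK.swap_swap v b b v] at e₃
  have hav : K a b b v = polarization K a v b b / 2 := by
    rw [hK.polarization_comm, ← hdiag]; ring
  rw [hav, hK.swap_swap a b b a, hK.swap_swap v b b v] at e₅
  simp only [rootForm]
  generalize K b a a b = c at *
  generalize polarization K a v b b = p at *
  generalize polarization K a v b w = m at *
  linear_combination -4 * c ^ 2 * e₂ + 4 * c * p * e₁ - 4 * c * K b a a w * e₃
    + (4 * c * K b v v b - 4 * p ^ 2) * e₄ + 12 * K b a a w ^ 2 * e₅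

lemma rootForm_add_left (hK : IsCurvatureForm K) (a b v v' w : V) :
    rootForm K a b (v + v') w = rootForm K a b v w + rootForm K a b v' w := by
  simp only [rootForm, polarization, hK.add_snd, hK.add_trd]; ring

lemma rootForm_smul_left (hK : IsCurvatureForm K) (a b : V) (s : ℝ) (v w : V) :
    rootForm K a b (s • v) w = s * rootForm K a b v w := by
  simp only [rootForm, polarization, hK.smul_snd, hK.smul_trd]; ring

lemma rootForm_add_right (hK : IsCurvatureForm K) (a b v w w' : V) :
    rootForm K a b v (w + w') = rootForm K a b v w + rootForm K a b v w' := by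
  simp only [rootForm, polarization, hK.add_fth]; ring

lemma rootForm_smul_right (hK : IsCurvatureForm K) (a b : V) (s : ℝ) (v w : V) :
    rootForm K a b v (s • w) = s * rootForm K a b v w := by
  simp only [rootForm, polarization, hK.smul_fth]; ring

end Module

section InnerProduct

variable [NormedAddCommGroup V] [InnerProductSpace ℝ V]

lemma of_tensor (R : V →ₗ[ℝ] V →ₗ[ℝ] V →ₗ[ℝ] V)
    (hskew : ∀ x y z : V, R x y z = -R y x z)
    (hpair : ∀ x y z w : V, ⟪R x y z, w⟫_ℝ = ⟪R z w x, y⟫_ℝ)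
    (hbianchi : ∀ x y z : V, R x y z + R y z x + R z x y = 0) :
    IsCurvatureForm fun x y z w => ⟪R x y z, w⟫_ℝ where
  add_fst x x' y z w := by simp [inner_add_left]
  smul_fst s x y z w := by simp [real_inner_smul_left]
  skew x y z w := by rw [hskew, inner_neg_left]
  pair := hpair
  bianchi x y z w := by rw [← inner_add_left, ← inner_add_left, hbianchi, inner_zero_left]

lemma constant_curvature :
    IsCurvatureForm fun x y z w : V => ⟪⟪y, z⟫_ℝ • x - ⟪x, z⟫_ℝ • y, w⟫_ℝ where
  add_fst x x' y z w := by
    simp only [inner_add_left, inner_sub_left, real_inner_smul_left]; ring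
  smul_fst s x y z w := by simp only [inner_sub_left, real_inner_smul_left]; ring
  skew x y z w := by simp only [inner_sub_left, real_inner_smul_left]; ring
  pair x y z w := by
    simp only [inner_sub_left, real_inner_smul_left]
    rw [real_inner_comm x w, real_inner_comm y z, real_inner_comm x z, real_inner_comm y w]; ring
  bianchi x y z w := by
    simp only [inner_sub_left, real_inner_smul_left]
    rw [real_inner_comm x y, real_inner_comm x z, real_inner_comm y z]; ring

lemma of_skewAdjoint (A : V →ₗ[ℝ] V) (hA : ∀ x y : V, ⟪A x, y⟫_ℝ = -⟪x, A y⟫_ℝ) :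
    IsCurvatureForm fun x y z w : V =>
      ⟪(2 * ⟪x, A y⟫_ℝ) • A z + ⟪x, A z⟫_ℝ • A y - ⟪y, A z⟫_ℝ • A x, w⟫_ℝ := by
  have hswap (x y : V) : ⟪x, A y⟫_ℝ = -⟪y, A x⟫_ℝ := by rw [real_inner_comm, hA]
  constructor
  · intro x x' y z w
    simp only [map_add, inner_add_left, inner_sub_left, real_inner_smul_left]; ring
  · intro s x y z w
    simp only [map_smul, inner_add_left, inner_sub_left, real_inner_smul_left]; ring
  · intro x y z w
    simp only [inner_add_left, inner_sub_left, real_inner_smul_left]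
    rw [hswap y x]; ring
  · intro x y z w
    simp only [inner_add_left, inner_sub_left, real_inner_smul_left, hA]
    rw [hswap z x, hswap z y, hswap w x, hswap w y]; ring
  · intro x y z w
    simp only [inner_add_left, inner_sub_left, real_inner_smul_left]
    rw [hswap y x, hswap z x, hswap z y]; ring

/-- A bilinear form on a finite-dimensional space is represented by an endomorphism. -/
lemma exists_endomorphism_of_bilinear [FiniteDimensional ℝ V] (f : V →ₗ[ℝ] V →ₗ[ℝ] ℝ) :
    ∃ A : V →ₗ[ℝ] V, ∀ x y : V, ⟪A x, y⟫_ℝ = f x y := by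
  have h (x y : V) : ⟪(InnerProductSpace.toDual ℝ V).symm
      (LinearMap.toContinuousLinearMap (f x)), y⟫_ℝ = f x y := by
    rw [InnerProductSpace.toDual_symm_apply]; rfl
  refine ⟨⟨⟨fun x => (InnerProductSpace.toDual ℝ V).symm
    (LinearMap.toContinuousLinearMap (f x)), fun x y => ?_⟩, fun s x => ?_⟩, h⟩
  · simp
  · simp

/-- Almost isotropy of `R` says that the Jacobi operators of `R - κ R₁` have vanishing minors. -/
lemma rank_one_of_almostIsotropic (R : V →ₗ[ℝ] V →ₗ[ℝ] V →ₗ[ℝ] V) (κ : ℝ)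
    (hAI : ∀ v : V, ‖v‖ = 1 → ∃ u : V, ∀ w : V, ⟪w, v⟫_ℝ = 0 →
      ∃ t : ℝ, R w v v - κ • w = t • u) {K : V → V → V → V → ℝ} (hK : IsCurvatureForm K)
    (hKR : ∀ x y z w : V,
      K x y z w = ⟪R x y z, w⟫_ℝ - κ * ⟪⟪y, z⟫_ℝ • x - ⟪x, z⟫_ℝ • y, w⟫_ℝ) (v w u : V) :
    K w v v w * K u v v u = K w v v u ^ 2 := by
  have unit (v : V) (hv : ‖v‖ = 1) (w u : V) : K w v v w * K u v v u = K w v v u ^ 2 := by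
    obtain ⟨u₀, hu₀⟩ := hAI v hv
    have hvv : ⟪v, v⟫_ℝ = 1 := by rw [real_inner_self_eq_norm_sq, hv]; norm_num
    have key (w : V) : ∃ t : ℝ, ∀ y, K w v v y = t * ⟪u₀, y⟫_ℝ := by
      have horth : ⟪w + (-⟪w, v⟫_ℝ) • v, v⟫_ℝ = 0 := by
        rw [inner_add_left, real_inner_smul_left, hvv]; ring
      obtain ⟨t, ht⟩ := hu₀ _ horth
      refine ⟨t, fun y => ?_⟩
      have hvanish : K v v v y = 0 := by linarith [hK.skew v v v y]
      have hproj : K (w + (-⟪w, v⟫_ℝ) • v) v v y = K w v v y := by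
        rw [hK.add_fst, hK.smul_fst, hvanish]; ring
      rw [← hproj, hKR, ← real_inner_smul_left u₀, ← ht, horth, hvv, one_smul, zero_smul,
        sub_zero, inner_sub_left, real_inner_smul_left _ _ κ]
    obtain ⟨t, ht⟩ := key w
    obtain ⟨t', ht'⟩ := key u
    rw [sq]
    nth_rewrite 3 [hK.reverse]
    rw [ht, ht, ht', ht']; ring
  rcases eq_or_ne v 0 with rfl | hv
  · have hzero (w u : V) : K w 0 0 u = 0 := by
      simpa using hK.smul_snd 0 w 0 0 u
    simp [hzero]
  · have hn : ‖v‖ ≠ 0 := norm_ne_zero_iff.mpr hv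
    have e := unit (‖v‖⁻¹ • v) (by rw [norm_smul, norm_inv, norm_norm, inv_mul_cancel₀ hn]) w u
    simp only [hK.smul_snd, hK.smul_trd] at e
    field_simp at e
    linarith

end InnerProduct

end IsCurvatureForm

end CurvatureForm

/-- **Theorem C (classification of almost isotropic algebraic curvature tensors).**
Let `(V, ⟪·,·⟫)` be a finite-dimensional real inner product space and `R` an algebraic
curvature tensor on `V` that is almost isotropic with associated constant `κ` (i.e.
`rank (𝒥_v - κ Id) ≤ 1` on `v^⊥` for every unit vector `v`, where `𝒥_v w = R w v v`).
Then either `R = κ R₁`, or there exist `τ ∈ {-1, 1}` and a nonzero skew-symmetric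
endomorphism `A : V → V` such that `R = κ R₁ + τ R_A`. -/
theorem almost_isotropic_curvature_classification
    {V : Type*} [NormedAddCommGroup V] [InnerProductSpace ℝ V] [FiniteDimensional ℝ V]
    (R : V →ₗ[ℝ] V →ₗ[ℝ] V →ₗ[ℝ] V) (κ : ℝ)
    (hskew : ∀ x y z : V, R x y z = - R y x z)
    (hpair : ∀ x y z w : V, ⟪R x y z, w⟫_ℝ = ⟪R z w x, y⟫_ℝ)
    (hbianchi : ∀ x y z : V, R x y z + R y z x + R z x y = 0)
    (hAI : ∀ v : V, ‖v‖ = 1 → ∃ u : V, ∀ w : V, ⟪w, v⟫_ℝ = 0 →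
      ∃ t : ℝ, R w v v - κ • w = t • u) :
    (∀ x y z : V, R x y z = κ • (⟪y, z⟫_ℝ • x - ⟪x, z⟫_ℝ • y)) ∨
    (∃ τ : ℝ, (τ = -1 ∨ τ = 1) ∧ ∃ A : V →ₗ[ℝ] V, A ≠ 0 ∧
      (∀ x y : V, ⟪A x, y⟫_ℝ = -⟪x, A y⟫_ℝ) ∧
      (∀ x y z : V, R x y z = κ • (⟪y, z⟫_ℝ • x - ⟪x, z⟫_ℝ • y) +
        τ • ((2 * ⟪x, A y⟫_ℝ) • A z + ⟪x, A z⟫_ℝ • A y - ⟪y, A z⟫_ℝ • A x))) := by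
  have hS := (IsCurvatureForm.of_tensor R hskew hpair hbianchi).sub
    (IsCurvatureForm.constant_curvature.const_mul κ)
  obtain ⟨K, hKR⟩ : ∃ K : V → V → V → V → ℝ, K = fun x y z w : V =>
    ⟪R x y z, w⟫_ℝ - κ * ⟪⟪y, z⟫_ℝ • x - ⟪x, z⟫_ℝ • y, w⟫_ℝ := ⟨_, rfl⟩
  rw [← hKR] at hS
  replace hKR (x y z w : V) : K x y z w =
    ⟪R x y z, w⟫_ℝ - κ * ⟪⟪y, z⟫_ℝ • x - ⟪x, z⟫_ℝ • y, w⟫_ℝ := by rw [hKR]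
  have hrank := IsCurvatureForm.rank_one_of_almostIsotropic R κ hAI hS hKR
  by_cases hflat : ∀ v w, K w v v w = 0
  · left
    intro x y z
    refine ext_inner_right ℝ fun w => ?_
    have e := hS.eq_zero_of_sectional hflat x y z w
    rw [hKR] at e
    rw [real_inner_smul_left]
    linarith
  right
  push Not at hflat
  obtain ⟨a, b, hc⟩ := hflat
  have hroot := hS.rootForm_sq hrank a b
  obtain ⟨r, hr⟩ : ∃ r : ℝ, r ^ 2 * (12 * |K b a a b| ^ 3) = 1 := by
    have : 0 < 12 * |K b a a b| ^ 3 := by positivity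
    refine ⟨(√(12 * |K b a a b| ^ 3))⁻¹, ?_⟩
    rw [inv_pow, Real.sq_sqrt this.le, inv_mul_cancel₀ this.ne']
  obtain ⟨τ, hτ, hτc⟩ : ∃ τ : ℝ, (τ = -1 ∨ τ = 1) ∧ τ * K b a a b ^ 3 = |K b a a b| ^ 3 := by
    rcases le_total 0 (K b a a b) with h | h
    · exact ⟨1, Or.inr rfl, by rw [abs_of_nonneg h]; ring⟩
    · exact ⟨-1, Or.inl rfl, by rw [abs_of_nonpos h]; ring⟩
  obtain ⟨A, hAf⟩ := IsCurvatureForm.exists_endomorphism_of_bilinear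
    (r • LinearMap.mk₂ ℝ (IsCurvatureForm.rootForm K a b) (hS.rootForm_add_left a b)
      (hS.rootForm_smul_left a b) (hS.rootForm_add_right a b) (hS.rootForm_smul_right a b))
  simp only [LinearMap.smul_apply, LinearMap.mk₂_apply, smul_eq_mul] at hAf
  have hsec (v w : V) : K w v v w = τ * (3 * ⟪A v, w⟫_ℝ ^ 2) := by
    rw [hAf]
    linear_combination -K w v v w * hr - 12 * r ^ 2 * K w v v w * hτc - 3 * τ * r ^ 2 * hroot v w
  have hdiag (v : V) : ⟪A v, v⟫_ℝ = 0 := by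
    have e := hsec v v
    rw [show K v v v v = 0 by linarith [hS.skew v v v v]] at e
    rcases hτ with rfl | rfl <;> nlinarith [sq_nonneg ⟪A v, v⟫_ℝ]
  have hA (x y : V) : ⟪A x, y⟫_ℝ = -⟪x, A y⟫_ℝ := by
    have e := hdiag (x + y)
    rw [map_add, inner_add_left, inner_add_right, inner_add_right, hdiag, hdiag] at e
    rw [real_inner_comm (A y) x]
    linarith
  refine ⟨τ, hτ, A, ?_, hA, fun x y z => ext_inner_right ℝ fun w => ?_⟩
  · rintro rfl
    exact hc (by simp [hsec])
  · have e := (hS.sub ((IsCurvatureForm.of_skewAdjoint A hA).const_mul τ)).eq_zero_of_sectional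
      (fun v w => by
        simp only [hsec, inner_add_left, inner_sub_left, real_inner_smul_left]
        rw [real_inner_comm (A v) v, hdiag, real_inner_comm (A v) w]
        ring) x y z w
    simp only [hKR] at e
    rw [inner_add_left, real_inner_smul_left, real_inner_smul_left]
    linarith
end

section
/- Let (V, ⟨·,·⟩, J) be a complex model with dim(V) ≥ 6, and let R be a Kähler algebraic curvature tensor on V that is almost isotropic with associated constant κ ≠ 0. Then R = κ·(R_1 + R_J). -/
open scoped InnerProductSpace

/-- `R` is a Kähler algebraic curvature tensor with respect to the orthogonal almost complex
structure `J`, and it is almost isotropic with associated constant `κ`. -/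
structure IsKahlerAlmostIsotropic {V : Type*} [NormedAddCommGroup V] [InnerProductSpace ℝ V]
    (J : V →ₗ[ℝ] V) (R : V →ₗ[ℝ] V →ₗ[ℝ] V →ₗ[ℝ] V) (κ : ℝ) : Prop where
  orth : ∀ x y : V, ⟪J x, J y⟫_ℝ = ⟪x, y⟫_ℝ
  sq : ∀ x : V, J (J x) = -x
  skew : ∀ x y z : V, R x y z = - R y x z
  pair : ∀ x y z w : V, ⟪R x y z, w⟫_ℝ = ⟪R z w x, y⟫_ℝ
  bianchi : ∀ x y z : V, R x y z + R y z x + R z x y = 0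
  kahler : ∀ x y z : V, R x y z = R (J x) (J y) z
  almostIsotropic : ∀ v : V, ‖v‖ = 1 → ∃ u : V, ∀ w : V, ⟪w, v⟫_ℝ = 0 →
    ∃ t : ℝ, R w v v - κ • w = t • u

namespace IsKahlerAlmostIsotropic

variable {V : Type*} [NormedAddCommGroup V] [InnerProductSpace ℝ V]
  {J : V →ₗ[ℝ] V} {R : V →ₗ[ℝ] V →ₗ[ℝ] V →ₗ[ℝ] V} {κ : ℝ}

theorem inner_J_left (h : IsKahlerAlmostIsotropic J R κ) (x y : V) :
    ⟪J x, y⟫_ℝ = -⟪x, J y⟫_ℝ := by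
  rw [← h.orth x (J y), h.sq, inner_neg_right, neg_neg]

theorem inner_J_self (h : IsKahlerAlmostIsotropic J R κ) (x : V) : ⟪J x, x⟫_ℝ = 0 := by
  have h₁ := h.inner_J_left x x
  rw [real_inner_comm (J x) x] at h₁
  linarith

theorem R_J (h : IsKahlerAlmostIsotropic J R κ) (x y z : V) : R x y (J z) = J (R x y z) := by
  refine ext_inner_right ℝ fun w => ?_
  rw [h.inner_J_left, h.pair x y z, h.kahler z, h.sq, h.pair x y (J z)]
  simp

theorem R_J_left (h : IsKahlerAlmostIsotropic J R κ) (x y z : V) :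
    R (J x) y z = - R x (J y) z := by
  rw [h.kahler (J x), h.sq]
  simp

theorem inner_R_swap (h : IsKahlerAlmostIsotropic J R κ) (x y z w : V) :
    ⟪R x y z, w⟫_ℝ = -⟪R x y w, z⟫_ℝ := by
  rw [h.pair, h.skew z w, inner_neg_left, ← h.pair]

theorem inner_R_self (h : IsKahlerAlmostIsotropic J R κ) (x y z : V) : ⟪R x y z, z⟫_ℝ = 0 := by
  have := h.inner_R_swap x y z z
  linarith

/-- Jacobi operators are symmetric. -/
theorem inner_jacobi_comm (h : IsKahlerAlmostIsotropic J R κ) (v a b : V) :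
    ⟪R a v v, b⟫_ℝ = ⟪R b v v, a⟫_ℝ := by
  rw [h.pair, h.skew, inner_neg_left, h.inner_R_swap, neg_neg]

/-- The sectional curvature is symmetric in the two vectors spanning the plane. -/
theorem inner_jacobi_swap (h : IsKahlerAlmostIsotropic J R κ) (v w : V) :
    ⟪R w v v, w⟫_ℝ = ⟪R v w w, v⟫_ℝ := by
  rw [h.pair]

/-- The `2 × 2` minors of `𝒥_v - κ` vanish. -/
theorem minor (h : IsKahlerAlmostIsotropic J R κ) {v w w' : V} (hw : ⟪w, v⟫_ℝ = 0)
    (hw' : ⟪w', v⟫_ℝ = 0) (a b : V) :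
    (⟪R w v v, a⟫_ℝ - κ * ⟪v, v⟫_ℝ * ⟪w, a⟫_ℝ) * (⟪R w' v v, b⟫_ℝ - κ * ⟪v, v⟫_ℝ * ⟪w', b⟫_ℝ) =
    (⟪R w v v, b⟫_ℝ - κ * ⟪v, v⟫_ℝ * ⟪w, b⟫_ℝ) *
      (⟪R w' v v, a⟫_ℝ - κ * ⟪v, v⟫_ℝ * ⟪w', a⟫_ℝ) := by
  rcases eq_or_ne v 0 with rfl | hv
  · simp
  obtain ⟨u, hu⟩ := h.almostIsotropic (‖v‖⁻¹ • v) (norm_smul_inv_norm hv)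
  have hn : ‖v‖ ≠ 0 := norm_ne_zero_iff.2 hv
  have key : ∀ z : V, ⟪z, v⟫_ℝ = 0 → ∃ t : ℝ, ∀ c : V,
      ⟪R z v v, c⟫_ℝ - κ * ⟪v, v⟫_ℝ * ⟪z, c⟫_ℝ = t * ⟪u, c⟫_ℝ := by
    intro z hz
    obtain ⟨t, ht⟩ := hu z (by rw [inner_smul_right, hz, mul_zero])
    refine ⟨‖v‖ ^ 2 * t, fun c => ?_⟩
    have hc := congrArg (fun y => ⟪y, c⟫_ℝ) ht
    simp only [map_smul, LinearMap.smul_apply, inner_sub_left, real_inner_smul_left] at hc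
    rw [real_inner_self_eq_norm_sq, mul_assoc (‖v‖ ^ 2), ← hc]
    field_simp
  obtain ⟨t, ht⟩ := key w hw
  obtain ⟨t', ht'⟩ := key w' hw'
  rw [ht, ht, ht', ht']
  ring

/-- A unit vector orthogonal to `w` that spans with `w` a plane of sectional curvature `κ`
lies in the kernel of `𝒥_w - κ`. -/
theorem jacobi_eq_of_inner (h : IsKahlerAlmostIsotropic J R κ) {v w : V} (hv : ⟪v, v⟫_ℝ = 1)
    (hw : ⟪w, w⟫_ℝ = 1) (hvw : ⟪v, w⟫_ℝ = 0) (hs : ⟪R v w w, v⟫_ℝ = κ) :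
    R v w w = κ • v := by
  have hb : ⟪R v w w - κ • v, w⟫_ℝ = 0 := by
    rw [inner_sub_left, h.inner_R_self, real_inner_smul_left, hvw]; ring
  set b := R v w w - κ • v with hb'
  have hm := h.minor hvw hb b v
  have hbb : ⟪R v w w, b⟫_ℝ - κ * ⟪v, b⟫_ℝ = ⟪b, b⟫_ℝ := by
    conv_rhs => rw [hb', inner_sub_left, ← hb', real_inner_smul_left]
  rw [h.inner_jacobi_comm w b v, real_inner_comm v b, hs, hv, hw, mul_one, hbb] at hm
  have : ⟪b, b⟫_ℝ = 0 := by
    have h2 : ⟪b, b⟫_ℝ * ⟪b, b⟫_ℝ = 0 := by rw [hm]; ring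
    exact mul_self_eq_zero.1 h2
  exact sub_eq_zero.1 (inner_self_eq_zero.1 this)

/-- The mixed term of `𝒥_{v + w}(Jv)`. -/
theorem R_mixed (h : IsKahlerAlmostIsotropic J R κ) {v w : V} (h₁ : R w v v = κ • w)
    (h₂ : R (J w) v v = κ • J w) : R (J v) v w + R (J v) w v = (3 * κ) • J w := by
  have e₁ : R (J v) w v = κ • J w := by
    rw [h.R_J_left, ← h.skew, h₂]
  have e₂ : R (J v) v w = (2 * κ) • J w := by
    have hb := h.bianchi (J v) v w
    rw [h.R_J, h.skew v w, h.skew w (J v), e₁, h₁, map_neg, map_smul] at hb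
    have : R (J v) v w = κ • J w + κ • J w := by
      rw [← sub_eq_zero, ← hb]; abel
    rw [this]; module
  rw [e₁, e₂]; module

/-- Expansion of `𝒥_{v + s w}(Jv)`. -/
theorem jacobi_add_smul (h : IsKahlerAlmostIsotropic J R κ) {v w : V} (h₁ : R w v v = κ • w)
    (h₂ : R (J w) v v = κ • J w) (h₃ : R (J v) w w = κ • J v) (s : ℝ) :
    R (J v) (v + s • w) (v + s • w) =
      R (J v) v v + (3 * κ * s) • J w + (s ^ 2 * κ) • J v := by
  have hm : R (J v) v w = (3 * κ) • J w - R (J v) w v := by rw [← h.R_mixed h₁ h₂]; abel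
  simp only [map_add, map_smul, LinearMap.add_apply, LinearMap.smul_apply, hm, h₃]
  module

/-- Expansion of `𝒥_{v + s w}(Jw)`. -/
theorem jacobi_add_smul' (h : IsKahlerAlmostIsotropic J R κ) {v w : V} (h₁ : R v w w = κ • v)
    (h₂ : R (J v) w w = κ • J v) (h₃ : R (J w) v v = κ • J w) (s : ℝ) :
    R (J w) (v + s • w) (v + s • w) =
      s ^ 2 • R (J w) w w + (3 * κ * s) • J v + κ • J w := by
  have hm : R (J w) w v = (3 * κ) • J v - R (J w) v w := by rw [← h.R_mixed h₁ h₂]; abel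
  simp only [map_add, map_smul, LinearMap.add_apply, LinearMap.smul_apply, hm, h₃]
  module

variable [FiniteDimensional ℝ V]

/-- Every unit vector `v` has a unit vector `w` orthogonal to `v` and `Jv` such that `w` and `Jw`
lie in the kernel of `𝒥_v - κ`. -/
theorem exists_partner (h : IsKahlerAlmostIsotropic J R κ) (hdim : 6 ≤ Module.finrank ℝ V)
    {v : V} (hv : ⟪v, v⟫_ℝ = 1) :
    ∃ w : V, ⟪w, w⟫_ℝ = 1 ∧ ⟪w, v⟫_ℝ = 0 ∧ ⟪w, J v⟫_ℝ = 0 ∧ R w v v = κ • w ∧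
      R (J w) v v = κ • J w := by
  have hv' : ‖v‖ = 1 := by
    rw [real_inner_self_eq_norm_sq] at hv
    exact (pow_eq_one_iff_of_nonneg (norm_nonneg v) two_ne_zero).1 hv
  obtain ⟨u, hu⟩ := h.almostIsotropic v hv'
  have key : ∀ w : V, ⟪w, v⟫_ℝ = 0 → ⟪w, u⟫_ℝ = 0 → R w v v = κ • w := by
    intro w hwv hwu
    rw [← sub_eq_zero]
    set b := R w v v - κ • w with hb'
    have hb : ⟪b, v⟫_ℝ = 0 := by
      rw [hb', inner_sub_left, h.inner_R_self, real_inner_smul_left, hwv]; ring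
    obtain ⟨t, ht⟩ := hu b hb
    have h₁ := congrArg (fun y => ⟪y, w⟫_ℝ) ht
    simp only [inner_sub_left, real_inner_smul_left, real_inner_comm w u, hwu] at h₁
    rw [h.inner_jacobi_comm, real_inner_comm w b] at h₁
    apply inner_self_eq_zero (𝕜 := ℝ) |>.1
    conv_lhs => rw [hb', inner_sub_left, ← hb', real_inner_smul_left]
    rw [h₁, mul_zero]
  let S : Submodule ℝ V := Submodule.span ℝ (Set.range ![v, J v, u, J u])
  have hS : Module.finrank ℝ S ≤ 4 :=
    finrank_range_le_card (R := ℝ) ![v, J v, u, J u]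
  have hne : Sᗮ ≠ ⊥ := by
    intro hbot
    have := S.finrank_add_finrank_orthogonal
    rw [hbot, finrank_bot] at this
    omega
  obtain ⟨w, hwS, hw0⟩ := Submodule.exists_mem_ne_zero_of_ne_bot hne
  have hmem : ∀ i, ⟪w, ![v, J v, u, J u] i⟫_ℝ = 0 := fun i =>
    Submodule.inner_left_of_mem_orthogonal (Submodule.subset_span (Set.mem_range_self i)) hwS
  have h0 : ⟪w, v⟫_ℝ = 0 := hmem 0
  have h1 : ⟪w, J v⟫_ℝ = 0 := hmem 1
  have h2 : ⟪w, u⟫_ℝ = 0 := hmem 2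
  have h3 : ⟪w, J u⟫_ℝ = 0 := hmem 3
  refine ⟨‖w‖⁻¹ • w, ?_, ?_, ?_, ?_, ?_⟩
  · rw [real_inner_self_eq_norm_sq, norm_smul, norm_inv, norm_norm,
      inv_mul_cancel₀ (norm_ne_zero_iff.2 hw0), one_pow]
  · rw [real_inner_smul_left, h0, mul_zero]
  · rw [real_inner_smul_left, h1, mul_zero]
  · exact key _ (by rw [real_inner_smul_left, h0, mul_zero])
      (by rw [real_inner_smul_left, h2, mul_zero])
  · exact key _ (by rw [h.inner_J_left, real_inner_smul_left, h1, mul_zero, neg_zero])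
      (by rw [h.inner_J_left, real_inner_smul_left, h3, mul_zero, neg_zero])

/-- `Jv` is an eigenvector of `𝒥_v`, with eigenvalue different from `κ`. -/
theorem exists_jacobi_J_eq (h : IsKahlerAlmostIsotropic J R κ) (hdim : 6 ≤ Module.finrank ℝ V)
    (hκ : κ ≠ 0) {v : V} (hv : ⟪v, v⟫_ℝ = 1) : ∃ μ : ℝ, μ ≠ κ ∧ R (J v) v v = μ • J v := by
  obtain ⟨w, hw, hwv, hwJv, h₁, h₂⟩ := h.exists_partner hdim hv
  have hvw : ⟪v, w⟫_ℝ = 0 := by rw [real_inner_comm, hwv]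
  have hJvw : ⟪J v, w⟫_ℝ = 0 := by rw [real_inner_comm, hwJv]
  have hJwv : ⟪J w, v⟫_ℝ = 0 := by rw [h.inner_J_left, hwJv, neg_zero]
  have hJv : ⟪J v, J v⟫_ℝ = 1 := by rw [h.orth, hv]
  have hJw : ⟪J w, J w⟫_ℝ = 1 := by rw [h.orth, hw]
  have hJvJw : ⟪J v, J w⟫_ℝ = 0 := by rw [h.orth, hvw]
  have hJwJv : ⟪J w, J v⟫_ℝ = 0 := by rw [h.orth, hwv]
  have h₃ : R v w w = κ • v := h.jacobi_eq_of_inner hv hw hvw (by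
    rw [← h.inner_jacobi_swap, h₁, real_inner_smul_left, hw, mul_one])
  have h₄ : R (J v) w w = κ • J v := h.jacobi_eq_of_inner hJv hw hJvw (by
    rw [← h.inner_jacobi_swap, h.R_J, ← neg_neg (R w (J v) v), ← h.R_J_left, h₂, map_neg, map_smul,
      h.sq, inner_neg_left, real_inner_smul_left, inner_neg_left, hw]
    ring)
  set μ := ⟪R (J v) v v, J v⟫_ℝ with hμ
  set z := R (J v) v v - μ • J v with hz
  have hRz : R (J v) v v = μ • J v + z := by rw [hz]; abel
  have hzJv : ⟪z, J v⟫_ℝ = 0 := by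
    rw [hz, inner_sub_left, ← hμ, real_inner_smul_left, hJv]; ring
  have hzJw : ⟪z, J w⟫_ℝ = 0 := by
    rw [hz, inner_sub_left, h.inner_jacobi_comm, h₂, real_inner_smul_left, real_inner_smul_left,
      hJwJv, hJvJw]; ring
  have hJvz : ⟪J v, z⟫_ℝ = 0 := by rw [real_inner_comm, hzJv]
  have hJwz : ⟪J w, z⟫_ℝ = 0 := by rw [real_inner_comm, hzJw]
  have hwJ : ⟪R (J w) w w, J v⟫_ℝ = 0 := by
    rw [h.inner_jacobi_comm, h₄, real_inner_smul_left, hJvJw, mul_zero]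
  have hx : ∀ s : ℝ, ⟪v + s • w, v + s • w⟫_ℝ = 1 + s ^ 2 := fun s => by
    simp only [inner_add_left, inner_add_right, real_inner_smul_left, real_inner_smul_right,
      hv, hw, hvw, hwv]; ring
  have m₁ := fun s : ℝ => h.minor (v := v + s • w) (w := J v) (w' := J w)
    (by rw [inner_add_right, real_inner_smul_right, h.inner_J_self, hJvw]; ring)
    (by rw [inner_add_right, real_inner_smul_right, h.inner_J_self, hJwv]; ring)
  simp only [hx, h.jacobi_add_smul h₁ h₂ h₄, h.jacobi_add_smul' h₃ h₄ h₂, hRz] at m₁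
  have e₁ := m₁ 1 (J v) (J w)
  have e₂ := m₁ 1 (J w) z
  have e₃ := m₁ (-1) (J w) z
  simp only [inner_add_left, real_inner_smul_left, hJv, hJw, hJvJw, hJwJv, hzJv, hzJw, hJvz,
    hJwz, hwJ] at e₁ e₂ e₃
  generalize ⟪R (J w) w w, J w⟫_ℝ = β at e₁ e₂ e₃
  generalize ⟪R (J w) w w, z⟫_ℝ = r at e₁ e₂ e₃
  have e₄ : (μ - κ) * (β - κ) = 9 * κ ^ 2 := by linear_combination e₁
  have hne : (μ - κ) * (β - κ) ≠ 0 := by rw [e₄]; positivity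
  refine ⟨μ, sub_ne_zero.1 (left_ne_zero_of_mul hne), ?_⟩
  have e₅ : ⟪z, z⟫_ℝ * (β - κ) = 0 := by linear_combination (-1 / 2) * e₂ + (-1 / 2) * e₃
  have hz0 : z = 0 :=
    inner_self_eq_zero.1 ((mul_eq_zero.1 e₅).resolve_right (right_ne_zero_of_mul hne))
  rw [hRz, hz0, add_zero]

/-- `𝒥_v = κ` on the orthogonal complement of `v` and `Jv`. -/
theorem jacobi_eq_of_orthogonal (h : IsKahlerAlmostIsotropic J R κ)
    (hdim : 6 ≤ Module.finrank ℝ V) (hκ : κ ≠ 0) {v w : V} (hv : ⟪v, v⟫_ℝ = 1)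
    (hwv : ⟪w, v⟫_ℝ = 0) (hwJv : ⟪w, J v⟫_ℝ = 0) : R w v v = κ • w := by
  obtain ⟨μ, hμ, hJ⟩ := h.exists_jacobi_J_eq hdim hκ hv
  refine ext_inner_right ℝ fun a => ?_
  have hm := h.minor hwv (h.inner_J_self v) a (J v)
  rw [h.inner_jacobi_comm v w (J v), hJ, real_inner_smul_left, real_inner_smul_left,
    real_inner_smul_left, real_inner_comm w (J v), h.orth, hwJv, hv] at hm
  have h₀ : (⟪R w v v, a⟫_ℝ - κ * ⟪w, a⟫_ℝ) * (μ - κ) = 0 := by linear_combination hm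
  rw [real_inner_smul_left]
  exact sub_eq_zero.1 ((mul_eq_zero.1 h₀).resolve_right (sub_ne_zero.2 hμ))

theorem jacobi_J_eq (h : IsKahlerAlmostIsotropic J R κ)
    (hdim : 6 ≤ Module.finrank ℝ V) (hκ : κ ≠ 0) {v : V} (hv : ⟪v, v⟫_ℝ = 1) :
    R (J v) v v = (4 * κ) • J v := by
  obtain ⟨w, hw, hwv, hwJv, h₁, h₂⟩ := h.exists_partner hdim hv
  obtain ⟨μ, -, hμ⟩ := h.exists_jacobi_J_eq hdim hκ hv
  obtain ⟨ν, -, hν⟩ := h.exists_jacobi_J_eq hdim hκ hw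
  have hvw : ⟪v, w⟫_ℝ = 0 := by rw [real_inner_comm, hwv]
  have hJvw : ⟪J v, w⟫_ℝ = 0 := by rw [real_inner_comm, hwJv]
  have hJwv : ⟪J w, v⟫_ℝ = 0 := by rw [h.inner_J_left, hwJv, neg_zero]
  have hvJw : ⟪v, J w⟫_ℝ = 0 := by rw [real_inner_comm, hJwv]
  have hJvJw : ⟪J v, J w⟫_ℝ = 0 := by rw [h.orth, hvw]
  have hJwJv : ⟪J w, J v⟫_ℝ = 0 := by rw [h.orth, hwv]
  have h₃ : R v w w = κ • v := h.jacobi_eq_of_orthogonal hdim hκ hw hvw hvJw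
  have h₄ : R (J v) w w = κ • J v := h.jacobi_eq_of_orthogonal hdim hκ hw hJvw hJvJw
  have hJv : ⟪J v, J v⟫_ℝ = 1 := by rw [h.orth, hv]
  have hJw : ⟪J w, J w⟫_ℝ = 1 := by rw [h.orth, hw]
  have hs : (√2)⁻¹ * (√2)⁻¹ = (1 / 2 : ℝ) := by
    rw [← mul_inv, Real.mul_self_sqrt (by norm_num)]; norm_num
  have hx : R (J w - J v) ((√2)⁻¹ • (v + (1 : ℝ) • w)) ((√2)⁻¹ • (v + (1 : ℝ) • w)) =
      κ • (J w - J v) := by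
    apply h.jacobi_eq_of_orthogonal hdim hκ
    · simp only [inner_add_left, inner_add_right, real_inner_smul_left, real_inner_smul_right,
        hv, hw, hvw, hwv]
      linear_combination 2 * hs
    · simp only [inner_sub_left, inner_add_right, real_inner_smul_right, h.inner_J_self, hJwv, hJvw]
      ring
    · simp only [map_add, map_smul, inner_sub_left, inner_add_right, real_inner_smul_right, hJv,
        hJw, hJvJw, hJwJv]
      ring
  simp only [map_smul, LinearMap.smul_apply, map_sub, LinearMap.sub_apply, smul_smul, hs] at hx
  have := congrArg (fun y => ⟪y, J v⟫_ℝ) hx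
  rw [h.jacobi_add_smul h₁ h₂ h₄, h.jacobi_add_smul' h₃ h₄ h₂, hμ, hν] at this
  simp only [inner_sub_left, inner_add_left, real_inner_smul_left, hJv, hJwJv] at this
  have hμ' : μ = 4 * κ := by linear_combination (-2) * this
  rw [hμ, hμ']

theorem jacobi_eq (h : IsKahlerAlmostIsotropic J R κ) (hdim : 6 ≤ Module.finrank ℝ V)
    (hκ : κ ≠ 0) (v w : V) :
    R w v v = κ • (⟪v, v⟫_ℝ • w - ⟪w, v⟫_ℝ • v + (3 * ⟪w, J v⟫_ℝ) • J v) := by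
  have unit : ∀ v : V, ⟪v, v⟫_ℝ = 1 →
      R w v v = κ • (w - ⟪w, v⟫_ℝ • v + (3 * ⟪w, J v⟫_ℝ) • J v) := by
    intro v hv
    have h₀ : R v v v = 0 := by
      linear_combination (norm := module) (1 / 2 : ℝ) • h.skew v v v
    have hJvv : ⟪v, J v⟫_ℝ = 0 := by rw [real_inner_comm, h.inner_J_self]
    have h₁ := h.jacobi_eq_of_orthogonal hdim hκ (w := w - ⟪w, v⟫_ℝ • v - ⟪w, J v⟫_ℝ • J v) hv
      (by simp only [inner_sub_left, real_inner_smul_left, hv, h.inner_J_self]; ring)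
      (by simp only [inner_sub_left, real_inner_smul_left, h.orth, hv, hJvv]; ring)
    simp only [map_sub, map_smul, LinearMap.sub_apply, LinearMap.smul_apply, h₀,
      h.jacobi_J_eq hdim hκ hv] at h₁
    rw [sub_eq_iff_eq_add, sub_eq_iff_eq_add] at h₁
    rw [h₁]
    module
  rcases eq_or_ne v 0 with rfl | hv
  · simp
  have hn : ‖v‖ ≠ 0 := norm_ne_zero_iff.2 hv
  have h₁ := unit (‖v‖⁻¹ • v) (by
    rw [real_inner_self_eq_norm_sq, norm_smul, norm_inv, norm_norm, inv_mul_cancel₀ hn, one_pow])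
  have h₂ := congrArg (fun y => (‖v‖ ^ 2) • y) h₁
  simp only [map_smul, LinearMap.smul_apply, real_inner_smul_right, smul_smul] at h₂
  have e : ‖v‖ ^ 2 * (‖v‖⁻¹ * ‖v‖⁻¹) = 1 := by field_simp
  rw [e, one_smul] at h₂
  rw [h₂, real_inner_self_eq_norm_sq]
  match_scalars <;> field_simp

end IsKahlerAlmostIsotropic

/-- **Theorem B(3).** Let `(V, ⟪·,·⟫, J)` be a complex model with `dim V ≥ 6` and let `R` be
a Kähler algebraic curvature tensor on `V` that is almost isotropic with associated constant
`κ ≠ 0`.  Then `R = κ (R₁ + R_J)`. -/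
theorem kahler_almost_isotropic_high_dim
    {V : Type*} [NormedAddCommGroup V] [InnerProductSpace ℝ V] [FiniteDimensional ℝ V]
    (hdim : 6 ≤ Module.finrank ℝ V)
    (J : V →ₗ[ℝ] V)
    (hJorth : ∀ x y : V, ⟪J x, J y⟫_ℝ = ⟪x, y⟫_ℝ)
    (hJ2 : ∀ x : V, J (J x) = -x)
    (R : V →ₗ[ℝ] V →ₗ[ℝ] V →ₗ[ℝ] V) (κ : ℝ) (hκ : κ ≠ 0)
    (hskew : ∀ x y z : V, R x y z = - R y x z)
    (hpair : ∀ x y z w : V, ⟪R x y z, w⟫_ℝ = ⟪R z w x, y⟫_ℝ)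
    (hbianchi : ∀ x y z : V, R x y z + R y z x + R z x y = 0)
    (hkahler : ∀ x y z : V, R x y z = R (J x) (J y) z)
    (hAI : ∀ v : V, ‖v‖ = 1 → ∃ u : V, ∀ w : V, ⟪w, v⟫_ℝ = 0 →
      ∃ t : ℝ, R w v v - κ • w = t • u) :
    ∀ x y z : V, R x y z =
      κ • ((⟪y, z⟫_ℝ • x - ⟪x, z⟫_ℝ • y) +
        ((2 * ⟪x, J y⟫_ℝ) • J z + ⟪x, J z⟫_ℝ • J y - ⟪y, J z⟫_ℝ • J x)) := by
  have h : IsKahlerAlmostIsotropic J R κ :=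
    ⟨hJorth, hJ2, hskew, hpair, hbianchi, hkahler, hAI⟩
  have polar : ∀ x y z : V, R x y z + R x z y =
      κ • ((2 * ⟪y, z⟫_ℝ) • x - ⟪x, z⟫_ℝ • y - ⟪x, y⟫_ℝ • z + (3 * ⟪x, J y⟫_ℝ) • J z
        + (3 * ⟪x, J z⟫_ℝ) • J y) := by
    intro x y z
    have hyz := h.jacobi_eq hdim hκ (y + z) x
    simp only [map_add, LinearMap.add_apply, inner_add_left, inner_add_right,
      h.jacobi_eq hdim hκ y x, h.jacobi_eq hdim hκ z x, real_inner_comm y z] at hyz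
    linear_combination (norm := module) hyz
  intro x y z
  have h₁ := polar x y z
  have h₂ := polar y x z
  rw [hskew x z y] at h₁
  rw [hskew y x z] at h₂
  have hb := hbianchi x y z
  have hJ : ⟪y, J x⟫_ℝ = -⟪x, J y⟫_ℝ := by rw [← h.inner_J_left, real_inner_comm]
  rw [hJ, real_inner_comm x y] at h₂
  linear_combination (norm := module) (1 / 3 : ℝ) • h₁ - (1 / 3 : ℝ) • h₂ + (1 / 3 : ℝ) • hb
end

section
/- Let D be a codimension-one totally geodesic distribution on the unit sphere S with singular set X, K = span(X), M = K^⊥, and S_M = M ∩ S. If m ∈ S_M, then K ⊆ D_m. -/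
open scoped InnerProductSpace

/-- **Lemma (Lemma 2.5-(1)).** Let `D` be a codimension-one totally geodesic distribution on
the unit sphere `S` with singular set `X = {s ∈ S : D_s = s^⊥}`, `K = span X`, `M = K^⊥`,
and `S_M = M ∩ S`.  If `m ∈ S_M`, then `K ⊆ D_m`. -/
theorem singular_span_subset_distribution
    {V : Type*} [NormedAddCommGroup V] [InnerProductSpace ℝ V] [FiniteDimensional ℝ V]
    (D : V → Submodule ℝ V)
    (hDsub : ∀ s : V, ‖s‖ = 1 → D s ≤ (ℝ ∙ s)ᗮ)
    (htg : ∀ s : V, ‖s‖ = 1 → ∀ w ∈ D s, ‖w‖ = 1 → ∀ t : ℝ,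
      (-(Real.sin t) • s + Real.cos t • w) ∈ D (Real.cos t • s + Real.sin t • w))
    (hcodim_ge : ∀ s : V, ‖s‖ = 1 →
      Module.finrank ℝ V - 2 ≤ Module.finrank ℝ (D s))
    (hcodim_eq : ∃ s : V, ‖s‖ = 1 ∧
      Module.finrank ℝ (D s) = Module.finrank ℝ V - 2)
    (K : Submodule ℝ V)
    (hK : K = Submodule.span ℝ {s : V | ‖s‖ = 1 ∧ D s = (ℝ ∙ s)ᗮ})
    (m : V) (hm : m ∈ Kᗮ) (hm1 : ‖m‖ = 1) :
    K ≤ D m := by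
  subst hK
  refine Submodule.span_le.mpr fun x hx => ?_
  have hmx : m ∈ D x := by
    rw [hx.2, Submodule.mem_orthogonal_singleton_iff_inner_right]
    exact (Submodule.mem_orthogonal _ m).mp hm x (Submodule.subset_span hx)
  have h := htg x hx.1 m hmx hm1 (Real.pi / 2)
  simpa using h
end

section
/- Let D be a codimension-one totally geodesic distribution on the unit sphere S with singular set X, K = span(X), M = K^⊥, and S_M = M ∩ S. If m ∈ S_M, then the subspace D_m ∩ (m^⊥ ∩ M) has codimension one in m^⊥ ∩ M, i.e. dim(D_m ∩ m^⊥ ∩ M) = dim(M) − 2. -/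
open scoped InnerProductSpace

/-- **Lemma (Lemma 2.5-(2)).** Let `D` be a codimension-one totally geodesic distribution on
the unit sphere `S` with singular set `X = {s ∈ S : D_s = s^⊥}`, `K = span X`, `M = K^⊥`,
and `S_M = M ∩ S`.  If `m ∈ S_M`, then `D_m ∩ (m^⊥ ∩ M)` has codimension one in
`m^⊥ ∩ M`, i.e. `dim (D_m ∩ m^⊥ ∩ M) = dim M - 2`. -/
theorem distribution_trace_on_SM_codim_one
    {V : Type*} [NormedAddCommGroup V] [InnerProductSpace ℝ V] [FiniteDimensional ℝ V]
    (D : V → Submodule ℝ V)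
    (hDsub : ∀ s : V, ‖s‖ = 1 → D s ≤ (ℝ ∙ s)ᗮ)
    (htg : ∀ s : V, ‖s‖ = 1 → ∀ w ∈ D s, ‖w‖ = 1 → ∀ t : ℝ,
      (-(Real.sin t) • s + Real.cos t • w) ∈ D (Real.cos t • s + Real.sin t • w))
    (hcodim_ge : ∀ s : V, ‖s‖ = 1 →
      Module.finrank ℝ V - 2 ≤ Module.finrank ℝ (D s))
    (hcodim_eq : ∃ s : V, ‖s‖ = 1 ∧
      Module.finrank ℝ (D s) = Module.finrank ℝ V - 2)
    (K : Submodule ℝ V)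
    (hK : K = Submodule.span ℝ {s : V | ‖s‖ = 1 ∧ D s = (ℝ ∙ s)ᗮ})
    (m : V) (hm : m ∈ Kᗮ) (hm1 : ‖m‖ = 1) :
    Module.finrank ℝ ↥(D m ⊓ ((ℝ ∙ m)ᗮ ⊓ Kᗮ)) = Module.finrank ℝ ↥Kᗮ - 2 := by
  have hKD : K ≤ D m := by
    rw [hK, Submodule.span_le]
    rintro x ⟨hx1, hx⟩
    have hxK : x ∈ K := hK ▸ Submodule.subset_span ⟨hx1, hx⟩
    have hmx : m ∈ D x := by
      rw [hx, Submodule.mem_orthogonal_singleton_iff_inner_right]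
      exact Submodule.inner_right_of_mem_orthogonal hxK hm
    simpa using htg x hx1 m hmx hm1 (Real.pi / 2)
  have hm0 : m ≠ 0 := fun h => by simp [h] at hm1
  have hlt : D m < (ℝ ∙ m)ᗮ := by
    refine lt_of_le_of_ne (hDsub m hm1) fun h => hm0 ?_
    have hmK : m ∈ K := hK ▸ Submodule.subset_span ⟨hm1, h⟩
    exact inner_self_eq_zero.mp (Submodule.inner_right_of_mem_orthogonal (𝕜 := ℝ) hmK hm)
  have hrank_lt := Submodule.finrank_lt_finrank_of_lt hlt
  have hrank_m := Submodule.finrank_add_finrank_orthogonal (ℝ ∙ m)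
  rw [finrank_span_singleton hm0] at hrank_m
  have hrank_ge := hcodim_ge m hm1
  have hrank_K := Submodule.finrank_add_finrank_orthogonal K
  have hrank_inf := Submodule.finrank_add_inf_finrank_orthogonal hKD
  have hinf : D m ⊓ ((ℝ ∙ m)ᗮ ⊓ Kᗮ) = Kᗮ ⊓ D m := by
    rw [← inf_assoc, inf_eq_left.mpr hlt.le, inf_comm]
  rw [hinf]
  omega
end

section
/- Let D be a codimension-one totally geodesic distribution on the unit sphere S with singular set X, K = span(X), M = K^⊥, and S_K = K ∩ S. If k ∈ S_K, then M ⊆ D_k. -/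
open scoped InnerProductSpace

/-- **Lemma (Lemma 2.5-(3)).** Let `D` be a codimension-one totally geodesic distribution on
the unit sphere `S` with singular set `X = {s ∈ S : D_s = s^⊥}`, `K = span X`, `M = K^⊥`,
and `S_K = K ∩ S`.  If `k ∈ S_K`, then `M ⊆ D_k`. -/
theorem orthocomplement_subset_distribution_at_singular_span
    {V : Type*} [NormedAddCommGroup V] [InnerProductSpace ℝ V] [FiniteDimensional ℝ V]
    (D : V → Submodule ℝ V)
    (hDsub : ∀ s : V, ‖s‖ = 1 → D s ≤ (ℝ ∙ s)ᗮ)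
    (htg : ∀ s : V, ‖s‖ = 1 → ∀ w ∈ D s, ‖w‖ = 1 → ∀ t : ℝ,
      (-(Real.sin t) • s + Real.cos t • w) ∈ D (Real.cos t • s + Real.sin t • w))
    (hcodim_ge : ∀ s : V, ‖s‖ = 1 →
      Module.finrank ℝ V - 2 ≤ Module.finrank ℝ (D s))
    (hcodim_eq : ∃ s : V, ‖s‖ = 1 ∧
      Module.finrank ℝ (D s) = Module.finrank ℝ V - 2)
    (K : Submodule ℝ V)
    (hK : K = Submodule.span ℝ {s : V | ‖s‖ = 1 ∧ D s = (ℝ ∙ s)ᗮ})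
    (k : V) (hk : k ∈ K) (hk1 : ‖k‖ = 1) :
    Kᗮ ≤ D k := by
  have symm : ∀ s w : V, ‖s‖ = 1 → ‖w‖ = 1 → w ∈ D s → s ∈ D w := by
    intro s w hs hw hws
    have h := htg s hs w hws hw (Real.pi / 2)
    simpa using h
  have unit_mem : ∀ m ∈ Kᗮ, ‖m‖ = 1 → m ∈ D k := by
    intro m hm hm1
    have hKD : K ≤ D m := by
      rw [hK, Submodule.span_le]
      rintro x ⟨hx1, hx⟩
      refine symm x m hx1 hm1 ?_
      rw [hx, Submodule.mem_orthogonal_singleton_iff_inner_right]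
      exact hm x (hK ▸ Submodule.subset_span ⟨hx1, hx⟩)
    exact symm m k hm1 hk1 (hKD hk)
  intro m hm
  rcases eq_or_ne m 0 with rfl | h0
  · exact zero_mem _
  · have hn : ‖m‖ ≠ 0 := norm_ne_zero_iff.mpr h0
    have h := unit_mem (‖m‖⁻¹ • m) (Kᗮ.smul_mem _ hm) (by rw [norm_smul, norm_inv, norm_norm, inv_mul_cancel₀ hn])
    exact ((D k).smul_mem_iff (inv_ne_zero hn)).mp h
end

section
/- Let D be a codimension-one totally geodesic distribution on the unit sphere S with singular set X, K = span(X), and S_K = K ∩ S. Then X = S_K. -/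
open scoped InnerProductSpace

/-- If `D x = xᗮ`, then `D z` contains the projection of `x` to `zᗮ`, which is tangent at `z` to
the great circle through `x` and `z`. -/
theorem sub_inner_smul_mem_of_eq_orthogonal
    {V : Type*} [NormedAddCommGroup V] [InnerProductSpace ℝ V]
    {D : V → Submodule ℝ V}
    (htg : ∀ s : V, ‖s‖ = 1 → ∀ w ∈ D s, ‖w‖ = 1 → ∀ t : ℝ,
      (-(Real.sin t) • s + Real.cos t • w) ∈ D (Real.cos t • s + Real.sin t • w))
    {x z : V} (hx : ‖x‖ = 1) (hDx : D x = (ℝ ∙ x)ᗮ) (hz : ‖z‖ = 1) :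
    x - ⟪x, z⟫_ℝ • z ∈ D z := by
  set c := ⟪x, z⟫_ℝ with hc
  have hxx : ⟪x, x⟫_ℝ = 1 := by rw [real_inner_self_eq_norm_sq, hx, one_pow]
  have hzz : ⟪z, z⟫_ℝ = 1 := by rw [real_inner_self_eq_norm_sq, hz, one_pow]
  obtain ⟨v, hv⟩ : ∃ v, v = z - c • x := ⟨_, rfl⟩
  have hnv : ‖v‖ ^ 2 = 1 - c ^ 2 := by
    rw [← real_inner_self_eq_norm_sq, hv]
    simp only [inner_sub_left, inner_sub_right, real_inner_smul_left, real_inner_smul_right,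
      hxx, hzz, real_inner_comm x z, ← hc]
    ring
  have hz_eq : z = c • x + v := by rw [hv]; abel
  have hproj : x - c • z = ‖v‖ ^ 2 • x - c • v := by
    rw [hnv, hz_eq]
    module
  by_cases h0 : v = 0
  · rw [hproj, h0]
    simp
  have hvpos : ‖v‖ ≠ 0 := norm_ne_zero_iff.mpr h0
  have hvD : v ∈ D x := by
    rw [hDx, Submodule.mem_orthogonal_singleton_iff_inner_right, hv, inner_sub_right,
      real_inner_smul_right, hxx, ← hc, mul_one, sub_self]
  have hw : ‖‖v‖⁻¹ • v‖ = 1 := by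
    rw [norm_smul, norm_inv, norm_norm, inv_mul_cancel₀ hvpos]
  have h := htg x hx (‖v‖⁻¹ • v) ((D x).smul_mem _ hvD) hw (Real.arccos c)
  have hc2 : c ^ 2 ≤ 1 := by nlinarith [sq_nonneg ‖v‖]
  obtain ⟨hc_ge, hc_le⟩ := abs_le.mp ((sq_le_one_iff_abs_le_one c).mp hc2)
  rw [Real.cos_arccos hc_ge hc_le, Real.sin_arccos, ← hnv, Real.sqrt_sq (norm_nonneg v),
    smul_inv_smul₀ hvpos, ← hz_eq] at h
  have h' := (D z).smul_mem (-‖v‖) h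
  convert h' using 1
  rw [hproj, smul_add, smul_smul, smul_smul, smul_smul]
  have : -‖v‖ * c * ‖v‖⁻¹ = -c := by field_simp
  rw [this]
  module

/-- **Lemma (Lemma 2.5-(4)).** Let `D` be a codimension-one totally geodesic distribution on
the unit sphere `S` with singular set `X = {s ∈ S : D_s = s^⊥}`, `K = span X`, and
`S_K = K ∩ S`.  Then `X = S_K`. -/
theorem singular_set_eq_sphere_of_span
    {V : Type*} [NormedAddCommGroup V] [InnerProductSpace ℝ V] [FiniteDimensional ℝ V]
    (D : V → Submodule ℝ V)
    (hDsub : ∀ s : V, ‖s‖ = 1 → D s ≤ (ℝ ∙ s)ᗮ)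
    (htg : ∀ s : V, ‖s‖ = 1 → ∀ w ∈ D s, ‖w‖ = 1 → ∀ t : ℝ,
      (-(Real.sin t) • s + Real.cos t • w) ∈ D (Real.cos t • s + Real.sin t • w))
    (hcodim_ge : ∀ s : V, ‖s‖ = 1 →
      Module.finrank ℝ V - 2 ≤ Module.finrank ℝ (D s))
    (hcodim_eq : ∃ s : V, ‖s‖ = 1 ∧
      Module.finrank ℝ (D s) = Module.finrank ℝ V - 2)
    (X : Set V) (hX : X = {s : V | ‖s‖ = 1 ∧ D s = (ℝ ∙ s)ᗮ})
    (K : Submodule ℝ V) (hK : K = Submodule.span ℝ X) :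
    X = {s : V | s ∈ K ∧ ‖s‖ = 1} := by
  subst hX hK
  ext z
  refine ⟨fun h => ⟨Submodule.subset_span h, h.1⟩, fun ⟨hzK, hz⟩ => ⟨hz, ?_⟩⟩
  refine le_antisymm (hDsub z hz) fun u hu => ?_
  have hproj : ∀ m : V, ‖m‖ = 1 → ∀ k ∈ Submodule.span ℝ {s : V | ‖s‖ = 1 ∧ D s = (ℝ ∙ s)ᗮ},
      k - ⟪k, m⟫_ℝ • m ∈ D m := by
    intro m hm k hk
    induction hk using Submodule.span_induction with
    | mem x hx => exact sub_inner_smul_mem_of_eq_orthogonal htg hx.1 hx.2 hm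
    | zero => simp
    | add x y _ _ ihx ihy =>
      convert (D m).add_mem ihx ihy using 1
      rw [inner_add_left]
      module
    | smul a x _ ih =>
      convert (D m).smul_mem a ih using 1
      rw [real_inner_smul_left]
      module
  by_cases h0 : u = 0
  · rw [h0]
    exact (D z).zero_mem
  have hupos : ‖u‖ ≠ 0 := norm_ne_zero_iff.mpr h0
  have hm : ‖‖u‖⁻¹ • u‖ = 1 := by
    rw [norm_smul, norm_inv, norm_norm, inv_mul_cancel₀ hupos]
  have hzm := hproj _ hm z hzK
  rw [Submodule.mem_orthogonal_singleton_iff_inner_right] at hu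
  rw [real_inner_smul_right, hu, mul_zero, zero_smul, sub_zero] at hzm
  have h := htg _ hm z hzm hz (Real.pi / 2)
  rw [Real.sin_pi_div_two, Real.cos_pi_div_two, zero_smul, zero_smul, add_zero, zero_add,
    one_smul] at h
  simpa [smul_smul, hupos] using (D z).smul_mem (-‖u‖) h
end

section
/- Let D be a codimension-one totally geodesic distribution on the unit sphere S with singular set X, K = span(X), M = K^⊥, S_K = K ∩ S, and S_M = M ∩ S. Let k ∈ S_K, m ∈ S_M, and T ∈ (0, π/2). If s = cos(T)k + sin(T)m, then D_s is the (internal) direct sum of the pairwise orthogonal subspaces k^⊥ ∩ K, D_m ∩ (m^⊥ ∩ M), and span(−sin(T)k + cos(T)m). -/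
open scoped InnerProductSpace

section TotallyGeodesic

variable {V : Type*} [NormedAddCommGroup V] [InnerProductSpace ℝ V]

/-- `D` is totally geodesic: a great circle tangent to `D` at one point is tangent to `D`
everywhere. -/
def IsTotallyGeodesic (D : V → Submodule ℝ V) : Prop :=
  ∀ s : V, ‖s‖ = 1 → ∀ w ∈ D s, ‖w‖ = 1 → ∀ t : ℝ,
    (-(Real.sin t) • s + Real.cos t • w) ∈ D (Real.cos t • s + Real.sin t • w)

namespace IsTotallyGeodesic

variable {D : V → Submodule ℝ V}

theorem mem_symm (hD : IsTotallyGeodesic D) {s w : V} (hs : ‖s‖ = 1) (hw : ‖w‖ = 1)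
    (h : w ∈ D s) : s ∈ D w := by
  have := hD s hs w h hw (Real.pi / 2)
  simpa using this

theorem mem_iff_mem_normalize (hD : IsTotallyGeodesic D) {s q : V} (hs : ‖s‖ = 1)
    (hq : q ≠ 0) : q ∈ D s ↔ s ∈ D (‖q‖⁻¹ • q) := by
  have hq' : ‖q‖⁻¹ ≠ 0 := inv_ne_zero (norm_ne_zero_iff.2 hq)
  have hn : ‖‖q‖⁻¹ • q‖ = 1 := norm_smul_inv_norm (𝕜 := ℝ) hq
  rw [← Submodule.smul_mem_iff (D s) hq']
  exact ⟨hD.mem_symm hs hn, hD.mem_symm hn hs⟩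

theorem sub_inner_smul_mem_of_singular (hD : IsTotallyGeodesic D) {x s : V} (hx : ‖x‖ = 1)
    (hs : ‖s‖ = 1) (hDx : D x = (ℝ ∙ x)ᗮ) : x - ⟪x, s⟫_ℝ • s ∈ D s := by
  set c := ⟪x, s⟫_ℝ with hc
  set v := s - c • x with hv
  have hxx : ⟪x, x⟫_ℝ = 1 := by simp [hx]
  have hss : ⟪s, s⟫_ℝ = 1 := by simp [hs]
  have hxv : ⟪x, v⟫_ℝ = 0 := by
    simp [hv, inner_sub_right, inner_smul_right, hx, ← hc]
  have hvsq : ‖v‖ ^ 2 = 1 - c ^ 2 := by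
    rw [← real_inner_self_eq_norm_sq, hv]
    simp only [inner_sub_left, inner_sub_right, inner_smul_left, inner_smul_right, hxx, hss,
      real_inner_comm x s, ← hc, conj_trivial]
    ring
  by_cases hv0 : v = 0
  · have hsx : s = c • x := sub_eq_zero.1 hv0
    have hc2 : c * c = 1 := by
      rw [hv0, norm_zero] at hvsq
      linarith
    rw [hsx, smul_smul, hc2, one_smul, sub_self]
    exact zero_mem _
  have hr : ‖v‖ ≠ 0 := norm_ne_zero_iff.2 hv0
  have hw : ‖v‖⁻¹ • v ∈ D x := by
    rw [hDx]
    exact Submodule.smul_mem _ _ (Submodule.mem_orthogonal_singleton_iff_inner_right.2 hxv)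
  have hcos : Real.cos (Real.arccos c) = c :=
    Real.cos_arccos (by nlinarith [sq_nonneg ‖v‖]) (by nlinarith [sq_nonneg ‖v‖])
  have hsin : Real.sin (Real.arccos c) = ‖v‖ := by
    rw [Real.sin_arccos, ← hvsq, Real.sqrt_sq (norm_nonneg v)]
  have h := hD x hx _ hw (norm_smul_inv_norm (𝕜 := ℝ) hv0) (Real.arccos c)
  rw [hcos, hsin, smul_inv_smul₀ hr, show c • x + v = s by rw [hv]; abel] at h
  convert Submodule.smul_mem _ (-‖v‖) h using 1
  rw [smul_comm c, smul_add, smul_smul, neg_mul_neg, ← sq, neg_smul, smul_inv_smul₀ hr, hvsq, hv]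
  module

theorem sub_inner_smul_mem_of_mem_span (hD : IsTotallyGeodesic D) {v s : V}
    (hv : v ∈ Submodule.span ℝ {x : V | ‖x‖ = 1 ∧ D x = (ℝ ∙ x)ᗮ}) (hs : ‖s‖ = 1) :
    v - ⟪v, s⟫_ℝ • s ∈ D s := by
  induction hv using Submodule.span_induction with
  | mem x hx => exact hD.sub_inner_smul_mem_of_singular hx.1 hs hx.2
  | zero => simp
  | add x y _ _ hx hy =>
    convert add_mem hx hy using 1
    rw [inner_add_left]
    module
  | smul a x _ hx =>
    convert Submodule.smul_mem _ a hx using 1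
    rw [real_inner_smul_left]
    module

theorem mem_of_mem_span_of_inner_eq_zero (hD : IsTotallyGeodesic D) {v s : V}
    (hv : v ∈ Submodule.span ℝ {x : V | ‖x‖ = 1 ∧ D x = (ℝ ∙ x)ᗮ}) (hs : ‖s‖ = 1)
    (h : ⟪v, s⟫_ℝ = 0) : v ∈ D s := by
  simpa [h] using hD.sub_inner_smul_mem_of_mem_span hv hs

/-- If `k` lies in the span of the singular set and `q` is orthogonal to `k`, then membership
of `q` in the distribution is constant along the open arc from `m` to `k`. -/
theorem mem_add_iff (hD : IsTotallyGeodesic D) {k m q : V} {a b : ℝ}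
    (hk : k ∈ Submodule.span ℝ {x : V | ‖x‖ = 1 ∧ D x = (ℝ ∙ x)ᗮ})
    (hm : ‖m‖ = 1) (hs : ‖a • k + b • m‖ = 1) (hb : b ≠ 0) (hkq : ⟪k, q⟫_ℝ = 0) :
    q ∈ D (a • k + b • m) ↔ q ∈ D m := by
  by_cases hq : q = 0
  · simp [hq]
  have hkD : k ∈ D (‖q‖⁻¹ • q) :=
    hD.mem_of_mem_span_of_inner_eq_zero hk (norm_smul_inv_norm (𝕜 := ℝ) hq)
      (by rw [real_inner_smul_right, hkq, mul_zero])
  rw [hD.mem_iff_mem_normalize hs hq, hD.mem_iff_mem_normalize hm hq,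
    Submodule.add_mem_iff_right _ (Submodule.smul_mem _ a hkD), Submodule.smul_mem_iff _ hb]

end IsTotallyGeodesic

end TotallyGeodesic

/-- **Lemma (Lemma 2.5-(5)).** Let `D` be a codimension-one totally geodesic distribution on
the unit sphere `S` with singular set `X = {s ∈ S : D_s = s^⊥}`, `K = span X`, `M = K^⊥`,
`S_K = K ∩ S`, `S_M = M ∩ S`.  Let `k ∈ S_K`, `m ∈ S_M`, `T ∈ (0, π/2)`, and
`s = cos T • k + sin T • m`.  Then `D_s` is the internal direct sum of the pairwise
orthogonal subspaces `k^⊥ ∩ K`, `D_m ∩ (m^⊥ ∩ M)`, and `span (-sin T • k + cos T • m)`. -/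
theorem distribution_decomposition_at_mixed_point
    {V : Type*} [NormedAddCommGroup V] [InnerProductSpace ℝ V] [FiniteDimensional ℝ V]
    (D : V → Submodule ℝ V)
    (hDsub : ∀ s : V, ‖s‖ = 1 → D s ≤ (ℝ ∙ s)ᗮ)
    (htg : ∀ s : V, ‖s‖ = 1 → ∀ w ∈ D s, ‖w‖ = 1 → ∀ t : ℝ,
      (-(Real.sin t) • s + Real.cos t • w) ∈ D (Real.cos t • s + Real.sin t • w))
    (hcodim_ge : ∀ s : V, ‖s‖ = 1 →
      Module.finrank ℝ V - 2 ≤ Module.finrank ℝ (D s))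
    (hcodim_eq : ∃ s : V, ‖s‖ = 1 ∧
      Module.finrank ℝ (D s) = Module.finrank ℝ V - 2)
    (K : Submodule ℝ V)
    (hK : K = Submodule.span ℝ {s : V | ‖s‖ = 1 ∧ D s = (ℝ ∙ s)ᗮ})
    (k : V) (hk : k ∈ K) (hk1 : ‖k‖ = 1)
    (m : V) (hm : m ∈ Kᗮ) (hm1 : ‖m‖ = 1)
    (T : ℝ) (hT : 0 < T ∧ T < Real.pi / 2)
    (s : V) (hs : s = Real.cos T • k + Real.sin T • m)
    (P₁ P₂ P₃ : Submodule ℝ V)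
    (hP₁ : P₁ = (ℝ ∙ k)ᗮ ⊓ K)
    (hP₂ : P₂ = D m ⊓ ((ℝ ∙ m)ᗮ ⊓ Kᗮ))
    (hP₃ : P₃ = ℝ ∙ (-(Real.sin T) • k + Real.cos T • m)) :
    (∀ x ∈ P₁, ∀ y ∈ P₂, ⟪x, y⟫_ℝ = 0) ∧
    (∀ x ∈ P₁, ∀ y ∈ P₃, ⟪x, y⟫_ℝ = 0) ∧
    (∀ x ∈ P₂, ∀ y ∈ P₃, ⟪x, y⟫_ℝ = 0) ∧
    D s = P₁ ⊔ P₂ ⊔ P₃ := by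
  have hD : IsTotallyGeodesic D := htg
  have hkm : ⟪k, m⟫_ℝ = 0 := Submodule.inner_right_of_mem_orthogonal hk hm
  have hmk : ⟪m, k⟫_ℝ = 0 := Submodule.inner_left_of_mem_orthogonal hk hm
  have hkk : ⟪k, k⟫_ℝ = 1 := by simp [hk1]
  have hmm : ⟪m, m⟫_ℝ = 1 := by simp [hm1]
  have hsin : Real.sin T ≠ 0 :=
    (Real.sin_pos_of_pos_of_lt_pi hT.1 (by linarith [Real.pi_pos])).ne'
  have hcs : Real.sin T ^ 2 + Real.cos T ^ 2 = 1 := Real.sin_sq_add_cos_sq T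
  have hs1 : ‖s‖ = 1 := by
    rw [← sq_eq_sq₀ (norm_nonneg s) zero_le_one, ← real_inner_self_eq_norm_sq, hs]
    simp only [inner_add_left, inner_add_right, real_inner_smul_left, real_inner_smul_right,
      hkk, hmm, hkm, hmk]
    linarith
  have mem₁ : ∀ x, x ∈ P₁ ↔ ⟪k, x⟫_ℝ = 0 ∧ x ∈ K := fun x => by
    rw [hP₁, Submodule.mem_inf, Submodule.mem_orthogonal_singleton_iff_inner_right]
  have mem₂ : ∀ x, x ∈ P₂ ↔ x ∈ D m ∧ ⟪m, x⟫_ℝ = 0 ∧ x ∈ Kᗮ := fun x => by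
    rw [hP₂, Submodule.mem_inf, Submodule.mem_inf,
      Submodule.mem_orthogonal_singleton_iff_inner_right]
  have hle₁ : P₁ ≤ D s := fun x hx => by
    obtain ⟨hkx, hxK⟩ := (mem₁ x).1 hx
    refine hD.mem_of_mem_span_of_inner_eq_zero (hK ▸ hxK) hs1 ?_
    rw [hs, inner_add_right, real_inner_smul_right, real_inner_smul_right,
      real_inner_comm, hkx, Submodule.inner_right_of_mem_orthogonal hxK hm]
    simp
  have hle₃ : P₃ ≤ D s := by
    rw [hP₃, Submodule.span_singleton_le_iff_mem,
      ← Submodule.smul_mem_iff (D s) (neg_ne_zero.2 hsin)]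
    convert hD.sub_inner_smul_mem_of_mem_span (hK ▸ hk) hs1 using 1
    have hks : ⟪k, s⟫_ℝ = Real.cos T := by
      simp [hs, inner_add_right, real_inner_smul_right, hk1, hkm]
    rw [hks, hs]
    linear_combination (norm := module) hcs • k
  have hiff : ∀ q ∈ Kᗮ, (q ∈ D s ↔ q ∈ D m) := fun q hq => by
    rw [hs]
    exact hD.mem_add_iff (hK ▸ hk) hm1 (hs ▸ hs1) hsin
      (Submodule.inner_right_of_mem_orthogonal hk hq)
  refine ⟨fun x hx y hy => ?_, fun x hx y hy => ?_, fun x hx y hy => ?_,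
    le_antisymm (fun w hw => ?_) (sup_le (sup_le hle₁ fun q hq => ?_) hle₃)⟩
  · exact Submodule.inner_right_of_mem_orthogonal ((mem₁ x).1 hx).2 ((mem₂ y).1 hy).2.2
  · obtain ⟨hkx, hxK⟩ := (mem₁ x).1 hx
    rw [hP₃] at hy
    obtain ⟨a, rfl⟩ := Submodule.mem_span_singleton.1 hy
    simp [inner_add_right, real_inner_smul_right, real_inner_comm k x, hkx,
      Submodule.inner_right_of_mem_orthogonal hxK hm]
  · obtain ⟨-, hmx, hxK⟩ := (mem₂ x).1 hx
    rw [hP₃] at hy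
    obtain ⟨a, rfl⟩ := Submodule.mem_span_singleton.1 hy
    simp [inner_add_right, real_inner_smul_right, real_inner_comm m x, hmx,
      Submodule.inner_left_of_mem_orthogonal hk hxK]
  · obtain ⟨y, hy, z, hz, rfl⟩ := K.exists_add_mem_mem_orthogonal w
    have hky : ⟪k, y - ⟪k, y⟫_ℝ • k⟫_ℝ = 0 := by
      simp [inner_sub_right, real_inner_smul_right, hk1]
    have hmz : ⟪m, z - ⟪m, z⟫_ℝ • m⟫_ℝ = 0 := by
      simp [inner_sub_right, real_inner_smul_right, hm1]
    have hp : y - ⟪k, y⟫_ℝ • k ∈ P₁ :=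
      (mem₁ _).2 ⟨hky, sub_mem hy (Submodule.smul_mem _ _ hk)⟩
    have hqM : z - ⟪m, z⟫_ℝ • m ∈ Kᗮ := sub_mem hz (Submodule.smul_mem _ _ hm)
    have horth : Real.cos T * ⟪k, y⟫_ℝ + Real.sin T * ⟪m, z⟫_ℝ = 0 := by
      have h := Submodule.mem_orthogonal_singleton_iff_inner_right.1 (hDsub s hs1 hw)
      rw [hs] at h
      simpa [inner_add_left, inner_add_right, real_inner_smul_left,
        Submodule.inner_right_of_mem_orthogonal hk hz,
        Submodule.inner_left_of_mem_orthogonal hy hm] using h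
    have hr : ⟪k, y⟫_ℝ • k + ⟪m, z⟫_ℝ • m ∈ P₃ := by
      rw [hP₃]
      refine Submodule.mem_span_singleton.2
        ⟨-Real.sin T * ⟪k, y⟫_ℝ + Real.cos T * ⟪m, z⟫_ℝ, ?_⟩
      linear_combination (norm := module) (⟪k, y⟫_ℝ * hcs - Real.cos T * horth) • k
        + (⟪m, z⟫_ℝ * hcs - Real.sin T * horth) • m
    have hdecomp : y + z = (y - ⟪k, y⟫_ℝ • k) + (z - ⟪m, z⟫_ℝ • m)
        + (⟪k, y⟫_ℝ • k + ⟪m, z⟫_ℝ • m) := by abel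
    have hqD : z - ⟪m, z⟫_ℝ • m ∈ D s := by
      rw [hdecomp, Submodule.add_mem_iff_left _ (hle₃ hr),
        Submodule.add_mem_iff_right _ (hle₁ hp)] at hw
      exact hw
    rw [hdecomp]
    exact Submodule.add_mem_sup
      (Submodule.add_mem_sup hp ((mem₂ _).2 ⟨(hiff _ hqM).1 hqD, hmz, hqM⟩)) hr
  · obtain ⟨hqD, -, hqM⟩ := (mem₂ q).1 hq
    exact (hiff q hqM).2 hqD
end

section
/- Let (V, ⟨·,·⟩) be a finite-dimensional real inner product space, A : V → V a skew-symmetric endomorphism, and κ, τ ∈ ℝ. Then the tensor R = κ·R_1 + τ·R_A is an algebraic curvature tensor that is almost isotropic with associated constant κ; more precisely, for every unit vector s ∈ V and every w ∈ s^⊥, its Jacobi operator satisfies 𝒥_s(w) = κ·w + 3τ·⟨w, As⟩·As. -/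
open scoped InnerProductSpace

/-- **Lemma 3.1.** Given a skew-symmetric endomorphism `A : V → V` of a finite-dimensional
real inner product space and constants `κ, τ ∈ ℝ`, the tensor `R = κ R₁ + τ R_A` is an
algebraic curvature tensor which is almost isotropic with associated constant `κ`; more
precisely, for each unit vector `s` and each `w ∈ s^⊥`,
`𝒥_s(w) = κ • w + 3τ ⟪w, As⟫ • As`. -/
theorem kappa_tau_A_tensor_is_almost_isotropic
    {V : Type*} [NormedAddCommGroup V] [InnerProductSpace ℝ V] [FiniteDimensional ℝ V]
    (A : V →ₗ[ℝ] V) (hA : ∀ x y : V, ⟪A x, y⟫_ℝ = -⟪x, A y⟫_ℝ)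
    (κ τ : ℝ) (R : V → V → V → V)
    (hR : ∀ x y z : V, R x y z = κ • (⟪y, z⟫_ℝ • x - ⟪x, z⟫_ℝ • y) +
      τ • ((2 * ⟪x, A y⟫_ℝ) • A z + ⟪x, A z⟫_ℝ • A y - ⟪y, A z⟫_ℝ • A x)) :
    (∀ x y z : V, R x y z = - R y x z) ∧
    (∀ x y z w : V, ⟪R x y z, w⟫_ℝ = ⟪R z w x, y⟫_ℝ) ∧
    (∀ x y z : V, R x y z + R y z x + R z x y = 0) ∧
    (∀ s : V, ‖s‖ = 1 → ∀ w : V, ⟪w, s⟫_ℝ = 0 →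
      R w s s = κ • w + (3 * τ * ⟪w, A s⟫_ℝ) • A s) ∧
    (∀ v : V, ‖v‖ = 1 → ∃ u : V, ∀ w : V, ⟪w, v⟫_ℝ = 0 →
      ∃ t : ℝ, R w v v - κ • w = t • u) := by
  have skew : ∀ x y : V, ⟪x, A y⟫_ℝ = -⟪y, A x⟫_ℝ := fun x y => by
    rw [real_inner_comm, hA]
  have skew_self : ∀ x : V, ⟪x, A x⟫_ℝ = 0 := fun x => by
    linarith [skew x x]
  have jacobi : ∀ s : V, ‖s‖ = 1 → ∀ w : V, ⟪w, s⟫_ℝ = 0 →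
      R w s s = κ • w + (3 * τ * ⟪w, A s⟫_ℝ) • A s := by
    intro s hs w hw
    rw [hR, hw, skew_self, real_inner_self_eq_norm_sq, hs]
    module
  refine ⟨fun x y z => ?_, fun x y z w => ?_, fun x y z => ?_, jacobi, fun v hv =>
    ⟨A v, fun w hw => ⟨3 * τ * ⟪w, A v⟫_ℝ, ?_⟩⟩⟩
  · rw [hR, hR, skew y x]
    module
  · simp only [hR, inner_add_left, inner_sub_left, real_inner_smul_left, hA]
    rw [skew w x, skew w y, skew z x, skew z y, real_inner_comm z x, real_inner_comm z y,
      real_inner_comm w x, real_inner_comm w y]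
    ring
  · rw [hR, hR, hR, skew y x, skew z y, skew z x, real_inner_comm x y, real_inner_comm x z,
      real_inner_comm y z]
    module
  · rw [jacobi v hv w hw, add_sub_cancel_left]
end

section
/- Let R be an algebraic curvature tensor on a finite-dimensional real inner product space (V, ⟨·,·⟩) that is almost isotropic with associated constant κ. Then the eigenspace distribution E on the unit sphere S, defined by E_s = ker(𝒥_s − κ·Id_{s^⊥}), is totally geodesic: if v, w ∈ S are orthonormal with w ∈ E_v, then for every t ∈ ℝ the vector −sin(t)v + cos(t)w lies in E_{cos(t)v + sin(t)w}. -/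
open scoped InnerProductSpace

/-- If a symmetric map on an invariant set `S` takes values in a line there, then every isotropic
vector of its quadratic form in `S` lies in its kernel. -/
theorem map_eq_zero_of_inner_self_eq_zero_of_range_line
    {V : Type*} [NormedAddCommGroup V] [InnerProductSpace ℝ V] {A : V → V} {S : Set V} {u v : V}
    (hsymm : ∀ x ∈ S, ∀ y ∈ S, ⟪A x, y⟫_ℝ = ⟪x, A y⟫_ℝ) (hS : ∀ x ∈ S, A x ∈ S)
    (hline : ∀ x ∈ S, ∃ t : ℝ, A x = t • u) (hv : v ∈ S) (hAv : ⟪A v, v⟫_ℝ = 0) :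
    A v = 0 := by
  obtain ⟨t, ht⟩ := hline v hv
  obtain ⟨s, hs⟩ := hline (A v) (hS v hv)
  rcases eq_or_ne t 0 with rfl | h
  · simpa using ht
  · have huv : ⟪u, v⟫_ℝ = 0 := by
      rw [ht, real_inner_smul_left] at hAv
      exact (mul_eq_zero.mp hAv).resolve_left h
    have hself := hsymm (A v) (hS v hv) v hv
    rw [hs, real_inner_smul_left, huv, mul_zero] at hself
    exact inner_self_eq_zero.mp hself.symm

/-- **Lemma 3.5.** Let `R` be an algebraic curvature tensor on a finite-dimensional real
inner product space that is almost isotropic with associated constant `κ`.  Then the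
eigenspace distribution `E_s = ker (𝒥_s - κ Id)` on the unit sphere is totally geodesic:
if `v, w` are orthonormal with `w ∈ E_v` (i.e. `R w v v = κ • w`), then for every `t` the
vector `-sin t • v + cos t • w` lies in `E_{cos t • v + sin t • w}`. -/
theorem eigenspace_distribution_totally_geodesic
    {V : Type*} [NormedAddCommGroup V] [InnerProductSpace ℝ V] [FiniteDimensional ℝ V]
    (R : V →ₗ[ℝ] V →ₗ[ℝ] V →ₗ[ℝ] V) (κ : ℝ)
    (hskew : ∀ x y z : V, R x y z = - R y x z)
    (hpair : ∀ x y z w : V, ⟪R x y z, w⟫_ℝ = ⟪R z w x, y⟫_ℝ)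
    (hbianchi : ∀ x y z : V, R x y z + R y z x + R z x y = 0)
    (hAI : ∀ v : V, ‖v‖ = 1 → ∃ u : V, ∀ w : V, ⟪w, v⟫_ℝ = 0 →
      ∃ t : ℝ, R w v v - κ • w = t • u)
    (v w : V) (hv : ‖v‖ = 1) (hw : ‖w‖ = 1) (hvw : ⟪v, w⟫_ℝ = 0)
    (hwEv : R w v v = κ • w) (t : ℝ) :
    R (-(Real.sin t) • v + Real.cos t • w) (Real.cos t • v + Real.sin t • w)
        (Real.cos t • v + Real.sin t • w) =
      κ • (-(Real.sin t) • v + Real.cos t • w) := by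
  have hskew' (x y z u : V) : ⟪R x y z, u⟫_ℝ = - ⟪R x y u, z⟫_ℝ := by
    rw [hpair, hskew, inner_neg_left, hpair]
  have hJsymm (x y : V) : ⟪R x w w, y⟫_ℝ = ⟪R y w w, x⟫_ℝ := by
    rw [hpair, hskew, inner_neg_left, hskew', neg_neg]
  have hself (x : V) : R x x = 0 := by
    ext z
    have h : (2 : ℝ) • R x x z = 0 := by
      rw [two_smul]
      exact eq_neg_iff_add_eq_zero.mp (hskew x x z)
    exact (smul_eq_zero.mp h).resolve_left two_ne_zero
  obtain ⟨u, hu⟩ := hAI w hw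
  have hker : R v w w - κ • v = 0 := by
    refine map_eq_zero_of_inner_self_eq_zero_of_range_line (A := fun x => R x w w - κ • x)
      (S := {x | ⟪x, w⟫_ℝ = 0}) (fun x _ y _ => ?_) (fun x hx => ?_) hu hvw ?_
    · simp only [inner_sub_left, inner_sub_right, real_inner_smul_left, real_inner_smul_right]
      rw [hJsymm, real_inner_comm]
    · simp only [Set.mem_ofPred_eq] at hx ⊢
      rw [inner_sub_left, real_inner_smul_left, hx, hpair, hself]
      simp
    · have hsec : ⟪R v w w, v⟫_ℝ = κ := by
        rw [hpair, hwEv, real_inner_smul_left, real_inner_self_eq_norm_sq, hw]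
        ring
      rw [inner_sub_left, hsec, real_inner_smul_left, real_inner_self_eq_norm_sq, hv]
      ring
  have hwv : R w v w = -(κ • v) := by
    rw [hskew, sub_eq_zero.mp hker]
  have hvwR : R v w = -R w v := by
    ext z
    exact hskew v w z
  have htrig := Real.sin_sq_add_cos_sq t
  have hrot : R (-(Real.sin t) • v + Real.cos t • w) (Real.cos t • v + Real.sin t • w)
      = R w v := by
    simp only [map_add, map_smul, LinearMap.add_apply, LinearMap.smul_apply, hself, hvwR]
    match_scalars
    linear_combination htrig
  rw [hrot, map_add, map_smul, map_smul, hwEv, hwv]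
  module
end

section
/- Let (V, ⟨·,·⟩, J) be a complex model, let A : V → V be a nonzero skew-symmetric endomorphism, let τ ∈ {−1, 1} and κ ∈ ℝ, and suppose the algebraic curvature tensor R = κ·R_1 + τ·R_A satisfies the Kähler symmetry R(x,y)z = R(Jx,Jy)z for all x,y,z ∈ V. Then A∘J = J∘A; in particular B = A∘J is a symmetric endomorphism. -/
open scoped InnerProductSpace

/-- If at every point one of two linear maps vanishes, then one of them is zero. -/
theorem LinearMap.eq_zero_or_eq_zero_of_forall {K V M N : Type*} [Ring K]
    [AddCommGroup V] [Module K V] [AddCommGroup M] [Module K M] [AddCommGroup N] [Module K N]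
    (f : V →ₗ[K] M) (g : V →ₗ[K] N) (h : ∀ x, f x = 0 ∨ g x = 0) : f = 0 ∨ g = 0 := by
  by_contra! hne
  obtain ⟨x, hx⟩ := DFunLike.ne_iff.mp hne.1
  obtain ⟨y, hy⟩ := DFunLike.ne_iff.mp hne.2
  have hgx : g x = 0 := (h x).resolve_left hx
  have hfy : f y = 0 := (h y).resolve_right hy
  rcases h (x + y) with h | h
  · exact hx (by simpa [hfy] using h)
  · exact hy (by simpa [hgx] using h)

/-- If the values of two bilinear forms always have product zero, then one of them is zero. -/
theorem LinearMap.BilinForm.eq_zero_or_eq_zero_of_mul_eq_zero {K V : Type*} [Field K]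
    [AddCommGroup V] [Module K V] (b c : LinearMap.BilinForm K V)
    (h : ∀ x y, b x y * c x y = 0) : b = 0 ∨ c = 0 :=
  LinearMap.eq_zero_or_eq_zero_of_forall b c fun x =>
    LinearMap.eq_zero_or_eq_zero_of_forall (b x) (c x) fun y => mul_eq_zero.mp (h x y)

/-- A linear form `f` with `f(y)² = f(Jy)²` for a complex structure `J` is zero. -/
theorem LinearMap.eq_zero_of_sq_eq_sq_comp_complexStructure {V : Type*}
    [AddCommGroup V] [Module ℝ V] (J : V →ₗ[ℝ] V) (hJ2 : ∀ x, J (J x) = -x)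
    (f : V →ₗ[ℝ] ℝ) (h : ∀ y, f y ^ 2 = f (J y) ^ 2) : f = 0 := by
  ext y
  have hy := h y
  have hyJ := h (y + J y)
  simp only [map_add, hJ2, map_neg] at hyJ
  have hprod : f y * f (J y) = 0 := by linarith
  rcases mul_eq_zero.mp hprod with h0 | h0
  · simpa using h0
  · simpa [h0] using hy

/-- **Lemma 4.6.** Let `(V, ⟪·,·⟫, J)` be a complex model, `A : V → V` a nonzero
skew-symmetric endomorphism, `τ ∈ {-1,1}`, `κ ∈ ℝ`, and suppose the algebraic curvature
tensor `R = κ R₁ + τ R_A` satisfies the Kähler symmetry `R(x,y)z = R(Jx,Jy)z`.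
Then `A ∘ J = J ∘ A`; in particular `B = A ∘ J` is a symmetric endomorphism. -/
theorem kahler_implies_A_commutes_with_J
    {V : Type*} [NormedAddCommGroup V] [InnerProductSpace ℝ V] [FiniteDimensional ℝ V]
    (J : V →ₗ[ℝ] V)
    (hJorth : ∀ x y : V, ⟪J x, J y⟫_ℝ = ⟪x, y⟫_ℝ)
    (hJ2 : ∀ x : V, J (J x) = -x)
    (A : V →ₗ[ℝ] V) (hA0 : A ≠ 0)
    (hA : ∀ x y : V, ⟪A x, y⟫_ℝ = -⟪x, A y⟫_ℝ)
    (τ : ℝ) (hτ : τ = -1 ∨ τ = 1) (κ : ℝ)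
    (R : V → V → V → V)
    (hR : ∀ x y z : V, R x y z = κ • (⟪y, z⟫_ℝ • x - ⟪x, z⟫_ℝ • y) +
      τ • ((2 * ⟪x, A y⟫_ℝ) • A z + ⟪x, A z⟫_ℝ • A y - ⟪y, A z⟫_ℝ • A x))
    (hkahler : ∀ x y z : V, R x y z = R (J x) (J y) z) :
    A ∘ₗ J = J ∘ₗ A ∧ (∀ x y : V, ⟪A (J x), y⟫_ℝ = ⟪x, A (J y)⟫_ℝ) := by
  have hJskew (x y : V) : ⟪J x, y⟫_ℝ = -⟪x, J y⟫_ℝ := by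
    rw [← hJorth x (J y), hJ2, inner_neg_right, neg_neg]
  have hJself (x : V) : ⟪x, J x⟫_ℝ = 0 := by
    have h := hJskew x x
    rw [real_inner_comm] at h
    linarith
  have hAself (x : V) : ⟪x, A x⟫_ℝ = 0 := by
    have h := hA x x
    rw [real_inner_comm] at h
    linarith
  have hAswap (x y : V) : ⟪y, A x⟫_ℝ = -⟪x, A y⟫_ℝ := by
    rw [real_inner_comm, hA]
  have hτ0 : τ ≠ 0 := by rcases hτ with rfl | rfl <;> norm_num
  have hsec (x y : V) :
      κ * (⟪x, x⟫_ℝ * ⟪y, y⟫_ℝ - ⟪x, y⟫_ℝ ^ 2) + τ * (3 * ⟪x, A y⟫_ℝ ^ 2) =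
        κ * ⟪x, J y⟫_ℝ ^ 2 + τ * (2 * ⟪J x, A (J y)⟫_ℝ * ⟪x, A y⟫_ℝ
          + ⟪J x, A y⟫_ℝ * ⟪x, A (J y)⟫_ℝ - ⟪J y, A y⟫_ℝ * ⟪x, A (J x)⟫_ℝ) := by
    have h := congrArg (fun v => ⟪x, v⟫_ℝ) (hkahler x y y)
    simp only [hR, inner_add_right, inner_sub_right, real_inner_smul_right, hAself,
      hJskew _ y, hJskew y, hJself] at h
    rw [hJskew y (A y)]
    linear_combination h
  have hsq (x y : V) : ⟪x, A y⟫_ℝ ^ 2 = ⟪J x, A (J y)⟫_ℝ ^ 2 := by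
    have h₁ := hsec x y
    have h₂ := hsec (J x) (J y)
    simp only [hJorth, hJ2, map_neg, inner_neg_right, inner_neg_left, hJskew x y] at h₂
    have hx := hAswap (J x) x
    have hy := hAswap (J y) y
    rw [hx] at h₁
    rw [hy] at h₂
    apply mul_left_cancel₀ hτ0
    linear_combination (h₁ - h₂) / 3
  let a : LinearMap.BilinForm ℝ V := (innerₗ V).compl₂ A
  let aJ : LinearMap.BilinForm ℝ V := (innerₗ V).compl₁₂ J (A ∘ₗ J)
  have ha (x y : V) : a x y = ⟪x, A y⟫_ℝ := rfl
  have haJ (x y : V) : aJ x y = ⟪J x, A (J y)⟫_ℝ := rfl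
  have hcomm : ∀ x y : V, ⟪J x, A (J y)⟫_ℝ = ⟪x, A y⟫_ℝ := by
    rcases LinearMap.BilinForm.eq_zero_or_eq_zero_of_mul_eq_zero (aJ - a) (aJ + a) (fun x y => by
      simp only [LinearMap.sub_apply, LinearMap.add_apply, ha, haJ]
      linear_combination -hsq x y) with h | h
    · intro x y
      have hxy := LinearMap.congr_fun₂ h x y
      simp only [LinearMap.sub_apply, LinearMap.zero_apply, ha, haJ] at hxy
      linarith
    · have hanti (x y : V) : ⟪J x, A (J y)⟫_ℝ = -⟪x, A y⟫_ℝ := by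
        have hxy := LinearMap.congr_fun₂ h x y
        simp only [LinearMap.add_apply, LinearMap.zero_apply, ha, haJ] at hxy
        linarith
      have hmixed (x y : V) : ⟪J x, A y⟫_ℝ = ⟪x, A (J y)⟫_ℝ := by
        have hxy := hanti x (J y)
        simp only [hJ2, map_neg, inner_neg_right] at hxy
        linarith
      have hAJself (x : V) : ⟪x, A (J x)⟫_ℝ = 0 := by
        have h₁ := hmixed x x
        have h₂ := hAswap (J x) x
        linarith
      have hzero (x : V) : a x = 0 := by
        refine LinearMap.eq_zero_of_sq_eq_sq_comp_complexStructure J hJ2 (a x) fun y => ?_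
        have h₁ := hsec x y
        have h₂ := hsec x (J y)
        simp only [hanti, hmixed, hAJself, hJorth, hJ2, map_neg, inner_neg_right] at h₁ h₂
        simp only [ha]
        apply mul_left_cancel₀ hτ0
        linear_combination (h₁ - h₂) / 6
      intro x y
      rw [← ha, ← ha, hzero, hzero]
      rfl
  have hAJ (x : V) : A (J x) = J (A x) := by
    refine ext_inner_left ℝ fun v => ?_
    have h := hcomm (J v) x
    rw [hJ2, inner_neg_left, hJskew] at h
    linarith
  refine ⟨LinearMap.ext hAJ, fun x y => ?_⟩
  rw [hA, hJskew, neg_neg, hAJ]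
end
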